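/- Assume the Klein–Gordon setup with c² > 1 and let Δ be the Hill discriminant associated with P(z) = V''(f(z))/(c²−1) and period T, and set F(ν) := −c²T²(4 − Δ(ν)²)/(4Δ'(ν)²) where Δ'(ν) ≠ 0. Then there exists N > 0 such that: for every a, b with a < b < −N, Δ(a)² = 4, Δ(b)² = 4, and Δ(ν)² > 4 for all ν ∈ (a,b) (an open gap of the Hill spectrum lying below −N), there exist ν₁, ν₂ with ν₁ < a < b < ν₂ < 0, Δ(νᵢ)² < 4 and Δ'(νᵢ) ≠ 0 and F(νᵢ) = νᵢ for i = 1, 2; consequently f exhibits dynamical Hamiltonian–Hopf instabilities at the two distinct points iβ₁ and iβ₂ of the positive imaginary axis, where βᵢ := |c²−1|·√(−νᵢ) > 0. -/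

import Mathlib

open Real Filter Set

noncomputable section

/-- The (Floquet) spectrum of the linearized Klein--Gordon spectral problem
`(c^2-1) w'' - 2 c lam w' + (lam^2 + Q z) w = 0`: the set of `lam : ℂ` for which
there is a nontrivial bounded solution `w : ℝ → ℂ`. -/
def KGSpectrum (c : ℝ) (Q : ℝ → ℝ) : Set ℂ :=
  {lam : ℂ | ∃ w wd wdd : ℝ → ℂ,
    (∀ z, HasDerivAt w (wd z) z) ∧ (∀ z, HasDerivAt wd (wdd z) z) ∧
    (∀ z : ℝ, ((c : ℂ) ^ 2 - 1) * wdd z - 2 * (c : ℂ) * lam * wd z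
        + (lam ^ 2 + (Q z : ℂ)) * w z = 0) ∧
    (∃ z, w z ≠ 0) ∧ (∃ M : ℝ, ∀ z, ‖w z‖ ≤ M)}

/-- The wave exhibits a dynamical Hamiltonian–Hopf instability at `lam` if every
neighborhood of `lam` contains a point of the spectrum that is not purely imaginary. -/
def HasDHHInstabilityAt (c : ℝ) (Q : ℝ → ℝ) (lam : ℂ) : Prop :=
  ∀ U ∈ nhds lam, ∃ μ ∈ KGSpectrum c Q, μ ∈ U ∧ μ.re ≠ 0

/-- `y1, y2` (with derivatives `y1d, y2d`) are the canonical fundamental solutions of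
Hill's equation `y'' + P y = ν y` with `y1(0)=1, y1'(0)=0, y2(0)=0, y2'(0)=1`,
for every value of the spectral parameter `ν`. -/
def IsHillFundamental (P : ℝ → ℝ) (y1 y1d y2 y2d : ℝ → ℝ → ℝ) : Prop :=
  ∀ ν : ℝ,
    (∀ z, HasDerivAt (y1 ν) (y1d ν z) z) ∧
    (∀ z, HasDerivAt (y1d ν) (ν * y1 ν z - P z * y1 ν z) z) ∧
    (∀ z, HasDerivAt (y2 ν) (y2d ν z) z) ∧
    (∀ z, HasDerivAt (y2d ν) (ν * y2 ν z - P z * y2 ν z) z) ∧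
    y1 ν 0 = 1 ∧ y1d ν 0 = 0 ∧ y2 ν 0 = 0 ∧ y2d ν 0 = 1


theorem summable_exp_bound (A B : ℝ) : Summable fun n : ℕ => A * B ^ n / (n.factorial : ℝ) := by
  have := (Real.summable_pow_div_factorial B).mul_left A
  simpa [mul_div_assoc] using this

theorem ps_deriv (a : ℕ → ℂ) (A B : ℝ) (hA : 0 ≤ A) (hB : 0 ≤ B)
    (ha : ∀ n, ‖a n‖ ≤ A * B ^ n / (n.factorial : ℝ)) :
    Differentiable ℂ (fun ζ : ℂ => ∑' n, ζ ^ n * a n) ∧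
    HasDerivAt (fun ζ : ℂ => ∑' n, ζ ^ n * a n) (a 1) 0 := by
  have key : ∀ ζ : ℂ, HasDerivAt (fun ζ : ℂ => ∑' n, ζ ^ n * a n)
      (∑' n : ℕ, ((n : ℂ) * ζ ^ (n - 1)) * a n) ζ := by
    intro ζ
    set R : ℝ := ‖ζ‖ + 1 with hR
    have hR1 : 1 ≤ R := by have := norm_nonneg ζ; linarith
    refine hasDerivAt_tsum_of_isPreconnected (g := fun (n : ℕ) (ζ : ℂ) => ζ ^ n * a n)
      (g' := fun (n : ℕ) (ζ : ℂ) => ((n : ℂ) * ζ ^ (n - 1)) * a n) (t := Metric.ball (0 : ℂ) R)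
      (u := fun n : ℕ => A * (2 * R * B) ^ n / (n.factorial : ℝ)) (y₀ := 0)
      (summable_exp_bound _ _) Metric.isOpen_ball (convex_ball _ _).isPreconnected ?_ ?_ ?_ ?_ ?_
    · intro n y _
      exact (hasDerivAt_pow n y).mul_const (a n)
    · intro n y hy
      have hy' : ‖y‖ ≤ R := by simpa using (Metric.mem_ball.1 hy).le
      rw [norm_mul, norm_mul, norm_pow]
      have h1 : ‖(n : ℂ)‖ ≤ 2 ^ n := by
        rw [Complex.norm_natCast]
        exact_mod_cast (Nat.lt_two_pow_self).le
      have h2 : ‖y‖ ^ (n - 1) ≤ R ^ n := by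
        calc ‖y‖ ^ (n - 1) ≤ R ^ (n - 1) := by gcongr
          _ ≤ R ^ n := pow_le_pow_right₀ hR1 (Nat.sub_le _ _)
      calc ‖(n : ℂ)‖ * ‖y‖ ^ (n - 1) * ‖a n‖ ≤ 2 ^ n * R ^ n * (A * B ^ n / (n.factorial : ℝ)) := by
            gcongr
            exact ha n
        _ = _ := by rw [mul_pow, mul_pow]; ring
    · simp; linarith
    · refine summable_of_ne_finset_zero (s := {0}) ?_
      intro n hn
      simp at hn
      simp [hn]
    · simp [hR]
  refine ⟨fun ζ => (key ζ).differentiableAt, ?_⟩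
  have h := key 0
  rw [tsum_eq_single 1] at h
  · simpa using h
  · intro n hn
    rcases n with _ | _ | n
    · simp
    · simp at hn
    · simp

def VK (y1 y2 p r u : ℝ → ℝ) : ℝ → ℝ := fun z =>
  r z * (∫ s in (0:ℝ)..z, y1 s * u s) - p z * (∫ s in (0:ℝ)..z, y2 s * u s)

def Vit (y1 y2 u0 : ℝ → ℝ) : ℕ → ℝ → ℝ
  | 0 => u0
  | n + 1 => VK y1 y2 y1 y2 (Vit y1 y2 u0 n)

def Vitd (y1 y1d y2 y2d u0 u0d : ℝ → ℝ) : ℕ → ℝ → ℝ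
  | 0 => u0d
  | n + 1 => VK y1 y2 y1d y2d (Vit y1 y2 u0 n)

def Vitdd (y1 y2 u0 q : ℝ → ℝ) : ℕ → ℝ → ℝ
  | 0 => fun z => q z * u0 z
  | n + 1 => fun z => q z * Vit y1 y2 u0 (n + 1) z + Vit y1 y2 u0 n z

/-- Fundamental system for the second-order linear equation with coefficient q. -/
structure Fund (q y1 y1d y2 y2d : ℝ → ℝ) : Prop where
  h1 : ∀ z, HasDerivAt y1 (y1d z) z
  h1d : ∀ z, HasDerivAt y1d (q z * y1 z) z
  h2 : ∀ z, HasDerivAt y2 (y2d z) z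
  h2d : ∀ z, HasDerivAt y2d (q z * y2 z) z
  i1 : y1 0 = 1
  i1d : y1d 0 = 0
  i2 : y2 0 = 0
  i2d : y2d 0 = 1

theorem cont_of_hd {f fd : ℝ → ℝ} (h : ∀ z, HasDerivAt f (fd z) z) : Continuous f :=
  continuous_iff_continuousAt.2 fun z => (h z).continuousAt

theorem const_of_hd {E : Type*} [NormedAddCommGroup E] [NormedSpace ℝ E]
    {g : ℝ → E} (h : ∀ z, HasDerivAt g 0 z) (z : ℝ) : g z = g 0 :=
  is_const_of_deriv_eq_zero (fun z => (h z).differentiableAt) (fun z => (h z).deriv) z 0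

theorem Fund.wronsk {q y1 y1d y2 y2d : ℝ → ℝ} (F : Fund q y1 y1d y2 y2d) (z : ℝ) :
    y1 z * y2d z - y1d z * y2 z = 1 := by
  have h : ∀ z, HasDerivAt (fun z => y1 z * y2d z - y1d z * y2 z) 0 z := by
    intro z
    convert! ((F.h1 z).mul (F.h2d z)).sub ((F.h1d z).mul (F.h2 z)) using 1
    ring
  have := const_of_hd h z
  simp only [F.i1, F.i1d, F.i2, F.i2d] at this
  linarith

theorem hd_int {g : ℝ → ℝ} (hg : Continuous g) (z : ℝ) :
    HasDerivAt (fun z => ∫ s in (0:ℝ)..z, g s) (g z) z :=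
  intervalIntegral.integral_hasDerivAt_right (hg.intervalIntegrable _ _)
    (hg.stronglyMeasurableAtFilter _ _) hg.continuousAt

theorem Fund.vk_hd {q y1 y1d y2 y2d : ℝ → ℝ} (F : Fund q y1 y1d y2 y2d) {u : ℝ → ℝ}
    (hu : Continuous u) (z : ℝ) :
    HasDerivAt (VK y1 y2 y1 y2 u) (VK y1 y2 y1d y2d u z) z := by
  have c1 := cont_of_hd F.h1
  have c2 := cont_of_hd F.h2
  unfold VK
  convert! ((F.h2 z).mul (hd_int (c1.mul hu) z)).sub ((F.h1 z).mul (hd_int (c2.mul hu) z)) using 1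
  simp only [Pi.mul_apply]
  ring

theorem Fund.vkd_hd {q y1 y1d y2 y2d : ℝ → ℝ} (F : Fund q y1 y1d y2 y2d) {u : ℝ → ℝ}
    (hu : Continuous u) (z : ℝ) :
    HasDerivAt (VK y1 y2 y1d y2d u) (q z * VK y1 y2 y1 y2 u z + u z) z := by
  have c1 := cont_of_hd F.h1
  have c2 := cont_of_hd F.h2
  have w := F.wronsk z
  unfold VK
  convert! ((F.h2d z).mul (hd_int (c1.mul hu) z)).sub ((F.h1d z).mul (hd_int (c2.mul hu) z)) using 1
  simp only [Pi.mul_apply]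
  linear_combination (- u z) * w

theorem Fund.vit_cont {q y1 y1d y2 y2d : ℝ → ℝ} (F : Fund q y1 y1d y2 y2d) {u0 u0d : ℝ → ℝ}
    (h0 : ∀ z, HasDerivAt u0 (u0d z) z) (n : ℕ) : Continuous (Vit y1 y2 u0 n) := by
  induction n with
  | zero => exact cont_of_hd h0
  | succ n ih => exact cont_of_hd (F.vk_hd ih)

theorem Fund.vit_hd {q y1 y1d y2 y2d : ℝ → ℝ} (F : Fund q y1 y1d y2 y2d) {u0 u0d : ℝ → ℝ}
    (h0 : ∀ z, HasDerivAt u0 (u0d z) z) (n : ℕ) (z : ℝ) :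
    HasDerivAt (Vit y1 y2 u0 n) (Vitd y1 y1d y2 y2d u0 u0d n z) z := by
  cases n with
  | zero => exact h0 z
  | succ n => exact F.vk_hd (F.vit_cont h0 n) z

theorem Fund.vitd_hd {q y1 y1d y2 y2d : ℝ → ℝ} (F : Fund q y1 y1d y2 y2d) {u0 u0d : ℝ → ℝ}
    (h0 : ∀ z, HasDerivAt u0 (u0d z) z) (h0d : ∀ z, HasDerivAt u0d (q z * u0 z) z)
    (n : ℕ) (z : ℝ) :
    HasDerivAt (Vitd y1 y1d y2 y2d u0 u0d n) (Vitdd y1 y2 u0 q n z) z := by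
  cases n with
  | zero => exact h0d z
  | succ n => exact F.vkd_hd (F.vit_cont h0 n) z

theorem int_pow_bound_nonneg {g : ℝ → ℝ} {C z : ℝ} (n : ℕ) (hz : 0 ≤ z)
    (hg : ∀ s, |s| ≤ |z| → |g s| ≤ C * |s| ^ n) :
    |∫ s in (0:ℝ)..z, g s| ≤ C * |z| ^ (n + 1) / (n + 1) := by
  have h := intervalIntegral.norm_integral_le_of_norm_le (f := g) (g := fun s => C * s ^ n)
    (μ := MeasureTheory.volume) hz (Filter.Eventually.of_forall (fun s hs => by
      have h1 : |s| = s := abs_of_pos hs.1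
      have h2 : |s| ≤ |z| := by rw [h1, abs_of_nonneg hz]; exact hs.2
      have := hg s h2
      rwa [h1] at this)) (by apply Continuous.intervalIntegrable; fun_prop)
  rw [intervalIntegral.integral_const_mul, integral_pow] at h
  rw [abs_of_nonneg hz]
  simpa [mul_div_assoc] using h

theorem int_pow_bound {g : ℝ → ℝ} {C z : ℝ} (n : ℕ)
    (hg : ∀ s, |s| ≤ |z| → |g s| ≤ C * |s| ^ n) :
    |∫ s in (0:ℝ)..z, g s| ≤ C * |z| ^ (n + 1) / (n + 1) := by
  rcases le_total 0 z with hz | hz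
  · exact int_pow_bound_nonneg n hz hg
  · have h := int_pow_bound_nonneg (g := fun s => g (-s)) (C := C) (z := -z) n (by linarith) (by
      intro s hs
      rw [abs_neg] at hs
      simpa using hg (-s) (by simpa using hs))
    rw [intervalIntegral.integral_comp_neg, abs_neg, neg_neg, neg_zero,
      intervalIntegral.integral_symm, abs_neg] at h
    exact h

theorem vk_bound {y1 y2 p r u : ℝ → ℝ} {L C R z : ℝ} (n : ℕ) (hL : 0 ≤ L)
    (b1 : ∀ s, |s| ≤ R → |y1 s| ≤ L) (b2 : ∀ s, |s| ≤ R → |y2 s| ≤ L)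
    (b3 : ∀ s, |s| ≤ R → |p s| ≤ L) (b4 : ∀ s, |s| ≤ R → |r s| ≤ L)
    (hu : ∀ s, |s| ≤ R → |u s| ≤ C * |s| ^ n) (hz : |z| ≤ R) :
    |VK y1 y2 p r u z| ≤ (2 * L ^ 2) * C / (n + 1) * |z| ^ (n + 1) := by
  have e1 := int_pow_bound (g := fun s => y1 s * u s) (C := L * C) (z := z) n (by
    intro s hs
    rw [abs_mul, mul_assoc]
    exact mul_le_mul (b1 s (hs.trans hz)) (hu s (hs.trans hz)) (abs_nonneg _) hL)
  have e2 := int_pow_bound (g := fun s => y2 s * u s) (C := L * C) (z := z) n (by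
    intro s hs
    rw [abs_mul, mul_assoc]
    exact mul_le_mul (b2 s (hs.trans hz)) (hu s (hs.trans hz)) (abs_nonneg _) hL)
  unfold VK
  refine (abs_sub _ _).trans ?_
  rw [abs_mul, abs_mul]
  have f1 := mul_le_mul (b4 z hz) e1 (abs_nonneg _) hL
  have f2 := mul_le_mul (b3 z hz) e2 (abs_nonneg _) hL
  refine (add_le_add f1 f2).trans (le_of_eq ?_)
  field_simp
  ring

theorem exists_bound {g : ℝ → ℝ} (hg : Continuous g) (R : ℝ) :
    ∃ L : ℝ, 0 ≤ L ∧ ∀ s, |s| ≤ R → |g s| ≤ L := by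
  obtain ⟨C, hC⟩ := (isCompact_Icc (a := -R) (b := R)).exists_bound_of_continuousOn hg.continuousOn
  refine ⟨max C 0, le_max_right _ _, fun s hs => ?_⟩
  exact (hC s (abs_le.1 hs)).trans (le_max_left _ _)

theorem Fund.bounds {q y1 y1d y2 y2d : ℝ → ℝ} (F : Fund q y1 y1d y2 y2d) {u0 u0d : ℝ → ℝ}
    (h0 : ∀ z, HasDerivAt u0 (u0d z) z) (h0d : ∀ z, HasDerivAt u0d (q z * u0 z) z) (R : ℝ) :
    ∃ A B : ℝ, 0 ≤ A ∧ 0 ≤ B ∧ ∀ n z, |z| ≤ R →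
      |Vit y1 y2 u0 n z| ≤ A * B ^ n / (n.factorial : ℝ) ∧
      |Vitd y1 y1d y2 y2d u0 u0d n z| ≤ A * B ^ n / (n.factorial : ℝ) := by
  obtain ⟨L1, p1, b1⟩ := exists_bound (cont_of_hd F.h1) R
  obtain ⟨L2, p2, b2⟩ := exists_bound (cont_of_hd F.h2) R
  obtain ⟨L3, p3, b3⟩ := exists_bound (cont_of_hd F.h1d) R
  obtain ⟨L4, p4, b4⟩ := exists_bound (cont_of_hd F.h2d) R
  obtain ⟨L5, p5, b5⟩ := exists_bound (cont_of_hd h0) R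
  obtain ⟨L6, p6, b6⟩ := exists_bound (cont_of_hd h0d) R
  set L := L1 + L2 + L3 + L4 with hL
  set A := L5 + L6 with hA
  have hL0 : 0 ≤ L := by positivity
  have hA0 : 0 ≤ A := by positivity
  have c1 : ∀ s, |s| ≤ R → |y1 s| ≤ L := fun s hs => (b1 s hs).trans (by linarith)
  have c2 : ∀ s, |s| ≤ R → |y2 s| ≤ L := fun s hs => (b2 s hs).trans (by linarith)
  have c3 : ∀ s, |s| ≤ R → |y1d s| ≤ L := fun s hs => (b3 s hs).trans (by linarith)
  have c4 : ∀ s, |s| ≤ R → |y2d s| ≤ L := fun s hs => (b4 s hs).trans (by linarith)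
  have key : ∀ n : ℕ, ∀ z, |z| ≤ R →
      |Vit y1 y2 u0 n z| ≤ (A * (2 * L ^ 2) ^ n / (n.factorial : ℝ)) * |z| ^ n ∧
      |Vitd y1 y1d y2 y2d u0 u0d n z| ≤ (A * (2 * L ^ 2) ^ n / (n.factorial : ℝ)) * |z| ^ n := by
    intro n
    induction n with
    | zero =>
      intro z hz
      simp only [Vit, Vitd, pow_zero, Nat.factorial_zero, Nat.cast_one, mul_one, div_one]
      exact ⟨(b5 z hz).trans (by linarith), (b6 z hz).trans (by linarith)⟩
    | succ n ih =>
      intro z hz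
      have hh : (2 * L ^ 2) * (A * (2 * L ^ 2) ^ n / (n.factorial : ℝ)) / (n + 1) =
          A * (2 * L ^ 2) ^ (n + 1) / ((n + 1).factorial : ℝ) := by
        rw [Nat.factorial_succ]
        push_cast
        field_simp
        ring
      constructor
      · have := vk_bound n hL0 c1 c2 c1 c2 (fun s hs => (ih s hs).1) hz
        rwa [hh] at this
      · have := vk_bound n hL0 c1 c2 c3 c4 (fun s hs => (ih s hs).1) hz
        rwa [hh] at this
  refine ⟨A, 2 * L ^ 2 * |R|, hA0, by positivity, fun n z hz => ?_⟩
  have hz' : |z| ^ n ≤ |R| ^ n :=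
    pow_le_pow_left₀ (abs_nonneg _) (hz.trans (le_abs_self R)) n
  have e : (A * (2 * L ^ 2) ^ n / (n.factorial : ℝ)) * |z| ^ n ≤
      A * (2 * L ^ 2 * |R|) ^ n / (n.factorial : ℝ) := by
    calc _ ≤ (A * (2 * L ^ 2) ^ n / (n.factorial : ℝ)) * |R| ^ n := by gcongr
      _ = _ := by rw [mul_pow (2 * L ^ 2) |R| n]; ring
  exact ⟨(key n z hz).1.trans e, (key n z hz).2.trans e⟩


theorem Fund.series_sol {q y1 y1d y2 y2d : ℝ → ℝ} (F : Fund q y1 y1d y2 y2d)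
    (hq : Continuous q) {u0 u0d : ℝ → ℝ}
    (h0 : ∀ z, HasDerivAt u0 (u0d z) z) (h0d : ∀ z, HasDerivAt u0d (q z * u0 z) z) :
    ∃ Y Yd : ℂ → ℝ → ℂ,
      (∀ ζ z, HasDerivAt (Y ζ) (Yd ζ z) z) ∧
      (∀ ζ z, HasDerivAt (Yd ζ) ((ζ + (q z : ℂ)) * Y ζ z) z) ∧
      (∀ ζ, Y ζ 0 = (u0 0 : ℂ)) ∧ (∀ ζ, Yd ζ 0 = (u0d 0 : ℂ)) ∧
      (∀ z, Y 0 z = (u0 z : ℂ)) ∧ (∀ z, Yd 0 z = (u0d z : ℂ)) ∧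
      (∀ z, Differentiable ℂ (fun ζ => Y ζ z)) ∧ (∀ z, Differentiable ℂ (fun ζ => Yd ζ z)) ∧
      (∀ z, HasDerivAt (fun ζ => Y ζ z) (VK y1 y2 y1 y2 u0 z : ℂ) 0) ∧
      (∀ z, HasDerivAt (fun ζ => Yd ζ z) (VK y1 y2 y1d y2d u0 z : ℂ) 0) := by
  set u := Vit y1 y2 u0 with hu
  set ud := Vitd y1 y1d y2 y2d u0 u0d with hud
  have hB := F.bounds h0 h0d
  have vk0 : ∀ p r v, VK y1 y2 p r v 0 = 0 := by intro p r v; simp [VK]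
  have nrm : ∀ (ζ : ℂ) (n : ℕ) (x A B : ℝ), |x| ≤ A * B ^ n / (n.factorial : ℝ) →
      ‖ζ ^ n * (x : ℂ)‖ ≤ A * (‖ζ‖ * B) ^ n / (n.factorial : ℝ) := by
    intro ζ n x A B h
    rw [norm_mul, norm_pow, Complex.norm_real, Real.norm_eq_abs]
    calc ‖ζ‖ ^ n * |x| ≤ ‖ζ‖ ^ n * (A * B ^ n / (n.factorial : ℝ)) := by gcongr
      _ = _ := by rw [mul_pow]; ring
  have sumu : ∀ (ζ : ℂ) z, Summable fun n => ζ ^ n * (u n z : ℂ) := by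
    intro ζ z
    obtain ⟨A, B, hA, hB0, hb⟩ := hB |z|
    exact Summable.of_norm_bounded (summable_exp_bound A (‖ζ‖ * B))
      fun n => nrm ζ n _ A B (hb n z le_rfl).1
  have sumud : ∀ (ζ : ℂ) z, Summable fun n => ζ ^ n * (ud n z : ℂ) := by
    intro ζ z
    obtain ⟨A, B, hA, hB0, hb⟩ := hB |z|
    exact Summable.of_norm_bounded (summable_exp_bound A (‖ζ‖ * B))
      fun n => nrm ζ n _ A B (hb n z le_rfl).2
  have mem : ∀ (z y : ℝ), y ∈ Metric.ball (0:ℝ) (|z| + 1) → |y| ≤ |z| + 1 := by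
    intro z y hy
    simpa using (Metric.mem_ball.1 hy).le
  refine ⟨fun ζ z => ∑' n, ζ ^ n * (u n z : ℂ), fun ζ z => ∑' n, ζ ^ n * (ud n z : ℂ),
    ?_, ?_, ?_, ?_, ?_, ?_, ?_, ?_, ?_, ?_⟩
  · intro ζ z
    obtain ⟨A, B, hA, hB0, hb⟩ := hB (|z| + 1)
    refine hasDerivAt_tsum_of_isPreconnected (g := fun (n : ℕ) (z : ℝ) => ζ ^ n * (u n z : ℂ))
      (g' := fun (n : ℕ) (z : ℝ) => ζ ^ n * (ud n z : ℂ)) (t := Metric.ball (0 : ℝ) (|z| + 1))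
      (y₀ := z) (summable_exp_bound A (‖ζ‖ * B)) Metric.isOpen_ball
      (convex_ball _ _).isPreconnected ?_ ?_ (by simp) (sumu ζ z) (by simp)
    · intro n y _
      exact ((F.vit_hd h0 n y).ofReal_comp).const_mul _
    · intro n y hy
      exact nrm ζ n _ A B (hb n y (mem z y hy)).2
  · intro ζ z
    obtain ⟨A, B, hA, hB0, hb⟩ := hB (|z| + 1)
    obtain ⟨C, hC, hbC⟩ := exists_bound hq (|z| + 1)
    set bd : ℕ → ℝ := fun n => A * (‖ζ‖ * B) ^ n / (n.factorial : ℝ) with hbd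
    have hsum1 := summable_exp_bound A (‖ζ‖ * B)
    have heq : (ζ + (q z : ℂ)) * ∑' n, ζ ^ n * (u n z : ℂ) =
        ∑' n, ζ ^ n * (Vitdd y1 y2 u0 q n z : ℂ) := by
      have e0 : ∑' n, ζ ^ n * (Vitdd y1 y2 u0 q n z : ℂ) =
          ζ ^ 0 * (Vitdd y1 y2 u0 q 0 z : ℂ) +
          ∑' n, ζ ^ (n + 1) * (Vitdd y1 y2 u0 q (n + 1) z : ℂ) := by
        refine Summable.tsum_eq_zero_add ?_
        refine (summable_nat_add_iff 1).1 ?_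
        have := (((summable_nat_add_iff 1).2 (sumu ζ z)).mul_left (q z : ℂ)).add
          ((sumu ζ z).mul_left ζ)
        refine this.congr fun n => ?_
        simp only [Vitdd, hu]
        push_cast
        ring
      rw [e0, add_mul, ← tsum_mul_left]
      have e1 : ∑' n, ζ ^ n * (u n z : ℂ) = ζ ^ 0 * (u 0 z : ℂ) +
          ∑' n, ζ ^ (n + 1) * (u (n + 1) z : ℂ) := (sumu ζ z).tsum_eq_zero_add
      rw [e1, mul_add, ← tsum_mul_left]
      have e2 : ∑' n, ζ ^ (n + 1) * (Vitdd y1 y2 u0 q (n + 1) z : ℂ) =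
          ∑' n, (q z : ℂ) * (ζ ^ (n + 1) * (u (n + 1) z : ℂ)) + ∑' n, ζ * (ζ ^ n * (u n z : ℂ)) := by
        rw [← Summable.tsum_add (((summable_nat_add_iff 1).2 (sumu ζ z)).mul_left (q z : ℂ))
          ((sumu ζ z).mul_left ζ)]
        congr 1
        ext n
        simp only [Vitdd, hu]
        push_cast
        ring
      rw [e2]
      simp only [Vitdd, hu, Vit]
      push_cast
      ring
    rw [heq]
    refine hasDerivAt_tsum_of_isPreconnected (g := fun (n : ℕ) (z : ℝ) => ζ ^ n * (ud n z : ℂ))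
      (g' := fun (n : ℕ) (z : ℝ) => ζ ^ n * (Vitdd y1 y2 u0 q n z : ℂ))
      (t := Metric.ball (0 : ℝ) (|z| + 1))
      (u := fun n => C * bd n + ‖ζ‖ * bd (n - 1))
      (y₀ := z) ?_ Metric.isOpen_ball
      (convex_ball _ _).isPreconnected ?_ ?_ (by simp) (sumud ζ z) (by simp)
    · refine (hsum1.mul_left C).add ?_
      refine (Summable.mul_left ‖ζ‖ ?_)
      refine (summable_nat_add_iff 1).1 ?_
      simpa using hsum1
    · intro n y _
      exact ((F.vitd_hd h0 h0d n y).ofReal_comp).const_mul _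
    · intro n y hy
      have hy' := mem z y hy
      have hqy := hbC y hy'
      have hbdpos : ∀ n, 0 ≤ bd n := fun n => by positivity
      cases n with
      | zero =>
        have h1 := nrm ζ 0 _ A B (hb 0 y hy').1
        have : ‖ζ ^ 0 * ((Vitdd y1 y2 u0 q 0 y : ℝ) : ℂ)‖ = |q y| * ‖ζ ^ 0 * ((Vit y1 y2 u0 0 y : ℝ) : ℂ)‖ := by
          simp [Vitdd, Vit]
        rw [this]
        have h2 : |q y| * ‖ζ ^ 0 * ((Vit y1 y2 u0 0 y : ℝ) : ℂ)‖ ≤ C * bd 0 := by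
          gcongr
        have h3 : 0 ≤ ‖ζ‖ * bd (0 - 1) := by positivity
        linarith
      | succ n =>
        have h1 := nrm ζ (n + 1) _ A B (hb (n + 1) y hy').1
        have h2 := nrm ζ n _ A B (hb n y hy').1
        have : ζ ^ (n + 1) * ((Vitdd y1 y2 u0 q (n + 1) y : ℝ) : ℂ) =
          (q y : ℂ) * (ζ ^ (n + 1) * ((Vit y1 y2 u0 (n + 1) y : ℝ) : ℂ)) +
            ζ * (ζ ^ n * ((Vit y1 y2 u0 n y : ℝ) : ℂ)) := by
          simp only [Vitdd]
          push_cast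
          ring
        rw [this]
        refine (norm_add_le _ _).trans ?_
        rw [norm_mul, norm_mul ζ, Complex.norm_real, Real.norm_eq_abs]
        simp only [Nat.add_sub_cancel]
        gcongr
  · intro ζ
    simp only
    rw [tsum_eq_single 0]
    · simp [hu, Vit]
    · intro n hn
      obtain ⟨m, rfl⟩ := Nat.exists_eq_succ_of_ne_zero hn
      simp [hu, Vit, vk0]
  · intro ζ
    simp only
    rw [tsum_eq_single 0]
    · simp [hud, Vitd]
    · intro n hn
      obtain ⟨m, rfl⟩ := Nat.exists_eq_succ_of_ne_zero hn
      simp [hud, Vitd, vk0]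
  · intro z
    simp only
    rw [tsum_eq_single 0]
    · simp [hu, Vit]
    · intro n hn
      simp [hn]
  · intro z
    simp only
    rw [tsum_eq_single 0]
    · simp [hud, Vitd]
    · intro n hn
      simp [hn]
  all_goals
    intro z
    obtain ⟨A, B, hA, hB0, hb⟩ := hB |z|
  · exact (ps_deriv (fun n => (u n z : ℂ)) A B hA hB0
      (fun n => by rw [Complex.norm_real]; exact (hb n z le_rfl).1)).1
  · exact (ps_deriv (fun n => (ud n z : ℂ)) A B hA hB0
      (fun n => by rw [Complex.norm_real]; exact (hb n z le_rfl).2)).1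
  · exact (ps_deriv (fun n => (u n z : ℂ)) A B hA hB0
      (fun n => by rw [Complex.norm_real]; exact (hb n z le_rfl).1)).2
  · exact (ps_deriv (fun n => (ud n z : ℂ)) A B hA hB0
      (fun n => by rw [Complex.norm_real]; exact (hb n z le_rfl).2)).2


/-- Complex fundamental system for the second-order linear equation with coefficient q. -/
structure CFund (q Y1 Y1d Y2 Y2d : ℝ → ℂ) : Prop where
  h1 : ∀ z, HasDerivAt Y1 (Y1d z) z
  h1d : ∀ z, HasDerivAt Y1d (q z * Y1 z) z
  h2 : ∀ z, HasDerivAt Y2 (Y2d z) z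
  h2d : ∀ z, HasDerivAt Y2d (q z * Y2 z) z
  i1 : Y1 0 = 1
  i1d : Y1d 0 = 0
  i2 : Y2 0 = 0
  i2d : Y2d 0 = 1

theorem wronsk_const {q a ad b bd : ℝ → ℂ} (ha : ∀ z, HasDerivAt a (ad z) z)
    (had : ∀ z, HasDerivAt ad (q z * a z) z) (hb : ∀ z, HasDerivAt b (bd z) z)
    (hbd : ∀ z, HasDerivAt bd (q z * b z) z) (z : ℝ) :
    a z * bd z - ad z * b z = a 0 * bd 0 - ad 0 * b 0 := by
  have h : ∀ z, HasDerivAt (fun z => a z * bd z - ad z * b z) 0 z := by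
    intro z
    convert! ((ha z).mul (hbd z)).sub ((had z).mul (hb z)) using 1
    ring
  exact const_of_hd h z

theorem CFund.wronsk {q Y1 Y1d Y2 Y2d : ℝ → ℂ} (F : CFund q Y1 Y1d Y2 Y2d) (z : ℝ) :
    Y1 z * Y2d z - Y1d z * Y2 z = 1 := by
  rw [wronsk_const F.h1 F.h1d F.h2 F.h2d z, F.i1, F.i1d, F.i2, F.i2d]
  ring

theorem CFund.uniq {q Y1 Y1d Y2 Y2d : ℝ → ℂ} (F : CFund q Y1 Y1d Y2 Y2d) {y yd : ℝ → ℂ}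
    (h : ∀ z, HasDerivAt y (yd z) z) (hd : ∀ z, HasDerivAt yd (q z * y z) z) (z : ℝ) :
    y z = y 0 * Y1 z + yd 0 * Y2 z ∧ yd z = y 0 * Y1d z + yd 0 * Y2d z := by
  have w := F.wronsk z
  have w1 := wronsk_const h hd F.h2 F.h2d z
  have w2 := wronsk_const F.h1 F.h1d h hd z
  rw [F.i2, F.i2d] at w1
  rw [F.i1, F.i1d] at w2
  constructor
  · linear_combination (- y z) * w + Y1 z * w1 + Y2 z * w2
  · linear_combination (- yd z) * w + Y1d z * w1 + Y2d z * w2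

theorem hill_fund {P : ℝ → ℝ} {y1 y1d y2 y2d : ℝ → ℝ → ℝ}
    (h : IsHillFundamental P y1 y1d y2 y2d) (ν : ℝ) :
    Fund (fun z => ν - P z) (y1 ν) (y1d ν) (y2 ν) (y2d ν) := by
  obtain ⟨h1, h2, h3, h4, h5, h6, h7, h8⟩ := h ν
  refine ⟨h1, fun z => ?_, h3, fun z => ?_, h5, h6, h7, h8⟩
  · simpa [sub_mul] using h2 z
  · simpa [sub_mul] using h4 z

theorem hill_complex {P : ℝ → ℝ} {y1 y1d y2 y2d : ℝ → ℝ → ℝ}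
    (h : IsHillFundamental P y1 y1d y2 y2d) (hP : Continuous P) (μ : ℝ) :
    ∃ Y1 Y1d Y2 Y2d : ℂ → ℝ → ℂ,
      (∀ ν, CFund (fun z => ν - (P z : ℂ)) (Y1 ν) (Y1d ν) (Y2 ν) (Y2d ν)) ∧
      (∀ z, Differentiable ℂ (fun ν => Y1 ν z)) ∧ (∀ z, Differentiable ℂ (fun ν => Y2d ν z)) ∧
      (∀ (ν : ℝ) z, Y1 ν z = (y1 ν z : ℂ)) ∧ (∀ (ν : ℝ) z, Y1d ν z = (y1d ν z : ℂ)) ∧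
      (∀ (ν : ℝ) z, Y2 ν z = (y2 ν z : ℂ)) ∧ (∀ (ν : ℝ) z, Y2d ν z = (y2d ν z : ℂ)) ∧
      (∀ z, HasDerivAt (fun ν => Y1 ν z) (VK (y1 μ) (y2 μ) (y1 μ) (y2 μ) (y1 μ) z : ℂ) (μ : ℂ)) ∧
      (∀ z, HasDerivAt (fun ν => Y1d ν z) (VK (y1 μ) (y2 μ) (y1d μ) (y2d μ) (y1 μ) z : ℂ) (μ : ℂ)) ∧
      (∀ z, HasDerivAt (fun ν => Y2 ν z) (VK (y1 μ) (y2 μ) (y1 μ) (y2 μ) (y2 μ) z : ℂ) (μ : ℂ)) ∧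
      (∀ z, HasDerivAt (fun ν => Y2d ν z) (VK (y1 μ) (y2 μ) (y1d μ) (y2d μ) (y2 μ) z : ℂ) (μ : ℂ)) := by
  have F := hill_fund h μ
  have hq : Continuous (fun z => μ - P z) := by fun_prop
  obtain ⟨Y, Yd, a1, a2, a3, a4, a5, a6, a7, a8, a9, a10⟩ := F.series_sol hq F.h1 F.h1d
  obtain ⟨Z, Zd, b1, b2, b3, b4, b5, b6, b7, b8, b9, b10⟩ := F.series_sol hq F.h2 F.h2d
  have CF : ∀ ν : ℂ, CFund (fun z => ν - (P z : ℂ)) (Y (ν - μ)) (Yd (ν - μ)) (Z (ν - μ)) (Zd (ν - μ)) := by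
    intro ν
    refine ⟨a1 _, fun z => ?_, b1 _, fun z => ?_, ?_, ?_, ?_, ?_⟩
    · convert! a2 (ν - μ) z using 1
      push_cast
      ring
    · convert! b2 (ν - μ) z using 1
      push_cast
      ring
    · rw [a3, F.i1]; simp
    · rw [a4, F.i1d]; simp
    · rw [b3, F.i2]; simp
    · rw [b4, F.i2d]; simp
  have sh : ∀ {g : ℂ → ℂ} {g' : ℂ}, HasDerivAt g g' 0 → HasDerivAt (fun ν => g (ν - μ)) g' (μ : ℂ) := by
    intro g g' hg
    have : HasDerivAt g g' ((μ : ℂ) - μ) := by simpa using hg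
    exact this.comp_sub_const (μ : ℂ) (μ : ℂ)
  have u1 : ∀ (ν : ℝ) z, ((y1 ν z : ℝ) : ℂ) = Y (ν - μ) z ∧ ((y1d ν z : ℝ) : ℂ) = Yd (ν - μ) z := by
    intro ν z
    have G := hill_fund h ν
    have := (CF ν).uniq (y := fun z => ((y1 ν z : ℝ) : ℂ)) (yd := fun z => ((y1d ν z : ℝ) : ℂ))
      (fun z => (G.h1 z).ofReal_comp) (fun z => by
        have := (G.h1d z).ofReal_comp
        push_cast at this
        exact this) z
    simpa [G.i1, G.i1d] using this
  have u2 : ∀ (ν : ℝ) z, ((y2 ν z : ℝ) : ℂ) = Z (ν - μ) z ∧ ((y2d ν z : ℝ) : ℂ) = Zd (ν - μ) z := by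
    intro ν z
    have G := hill_fund h ν
    have := (CF ν).uniq (y := fun z => ((y2 ν z : ℝ) : ℂ)) (yd := fun z => ((y2d ν z : ℝ) : ℂ))
      (fun z => (G.h2 z).ofReal_comp) (fun z => by
        have := (G.h2d z).ofReal_comp
        push_cast at this
        exact this) z
    simpa [G.i2, G.i2d] using this
  refine ⟨fun ν => Y (ν - μ), fun ν => Yd (ν - μ), fun ν => Z (ν - μ), fun ν => Zd (ν - μ), CF,
    fun z => (a7 z).comp (differentiable_id.sub_const _),
    fun z => (b8 z).comp (differentiable_id.sub_const _),
    fun ν z => (u1 ν z).1.symm, fun ν z => (u1 ν z).2.symm,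
    fun ν z => (u2 ν z).1.symm, fun ν z => (u2 ν z).2.symm,
    fun z => sh (a9 z), fun z => sh (a10 z), fun z => sh (b9 z), fun z => sh (b10 z)⟩

/-- Real derivatives of the monodromy entries in the spectral parameter. -/
theorem hill_real_deriv {P : ℝ → ℝ} {y1 y1d y2 y2d : ℝ → ℝ → ℝ}
    (h : IsHillFundamental P y1 y1d y2 y2d) (hP : Continuous P) (μ z : ℝ) :
    HasDerivAt (fun ν => y1 ν z) (VK (y1 μ) (y2 μ) (y1 μ) (y2 μ) (y1 μ) z) μ ∧
    HasDerivAt (fun ν => y1d ν z) (VK (y1 μ) (y2 μ) (y1d μ) (y2d μ) (y1 μ) z) μ ∧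
    HasDerivAt (fun ν => y2 ν z) (VK (y1 μ) (y2 μ) (y1 μ) (y2 μ) (y2 μ) z) μ ∧
    HasDerivAt (fun ν => y2d ν z) (VK (y1 μ) (y2 μ) (y1d μ) (y2d μ) (y2 μ) z) μ := by
  obtain ⟨Y1, Y1d, Y2, Y2d, -, -, -, r1, r2, r3, r4, d1, d2, d3, d4⟩ := hill_complex h hP μ
  refine ⟨?_, ?_, ?_, ?_⟩
  · simpa [r1] using (d1 z).real_of_complex
  · simpa [r2] using (d2 z).real_of_complex
  · simpa [r3] using (d3 z).real_of_complex
  · simpa [r4] using (d4 z).real_of_complex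

/-- Δ extends to an entire function. -/
theorem hill_entire {P : ℝ → ℝ} {y1 y1d y2 y2d : ℝ → ℝ → ℝ}
    (h : IsHillFundamental P y1 y1d y2 y2d) (hP : Continuous P) (T : ℝ) :
    ∃ D : ℂ → ℂ, Differentiable ℂ D ∧ (∀ ν : ℝ, D ν = ((y1 ν T + y2d ν T : ℝ) : ℂ)) ∧
     ∀ ν : ℂ, ∃ Y1 Y1d Y2 Y2d : ℝ → ℂ, CFund (fun z => ν - (P z : ℂ)) Y1 Y1d Y2 Y2d ∧
      D ν = Y1 T + Y2d T := by
  obtain ⟨Y1, Y1d, Y2, Y2d, CF, e1, e2, r1, r2, r3, r4, -⟩ := hill_complex h hP 0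
  refine ⟨fun ν => Y1 ν T + Y2d ν T, (e1 T).add (e2 T), fun ν => ?_, fun ν => ⟨_, _, _, _, CF ν, rfl⟩⟩
  simp only [r1, r4]
  push_cast
  rfl

/-- Δ is C¹ (indeed smooth) on the reals. -/
theorem hill_delta_smooth {P : ℝ → ℝ} {y1 y1d y2 y2d : ℝ → ℝ → ℝ}
    (h : IsHillFundamental P y1 y1d y2 y2d) (hP : Continuous P) (T : ℝ) (Δ : ℝ → ℝ)
    (hΔ : Δ = fun ν => y1 ν T + y2d ν T) :
    (∀ ν, HasDerivAt Δ (deriv Δ ν) ν) ∧ Continuous (deriv Δ) ∧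
    (∀ ν, deriv Δ ν = VK (y1 ν) (y2 ν) (y1 ν) (y2 ν) (y1 ν) T + 
      VK (y1 ν) (y2 ν) (y1d ν) (y2d ν) (y2 ν) T) := by
  obtain ⟨D, hD, hDr, -⟩ := hill_entire h hP T
  have e : ∀ ν : ℝ, HasDerivAt Δ (deriv D ν).re ν := by
    intro ν
    have := ((hD (ν : ℂ)).hasDerivAt).real_of_complex
    have h2 : (fun x : ℝ => (D x).re) = Δ := by
      ext x
      rw [hDr, hΔ]; simp
    rwa [h2] at this
  have e2 : ∀ ν, deriv Δ ν = (deriv D ν).re := fun ν => (e ν).deriv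
  refine ⟨fun ν => by rw [e2]; exact e ν, ?_, ?_⟩
  · have : deriv Δ = fun ν : ℝ => (deriv D ν).re := funext e2
    rw [this]
    have c : Continuous (deriv D) := by
      have : ContDiff ℂ 1 D := hD.contDiff
      exact this.continuous_deriv le_rfl
    exact Complex.continuous_re.comp (c.comp Complex.continuous_ofReal)
  · intro ν
    obtain ⟨d1, -, -, d4⟩ := hill_real_deriv h hP ν T
    have := d1.add d4
    rw [hΔ]
    exact this.deriv


theorem Fund.int_facts {q y1 y1d y2 y2d : ℝ → ℝ} (F : Fund q y1 y1d y2 y2d) {T : ℝ} (hT : 0 < T) :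
    0 < (∫ s in (0:ℝ)..T, y1 s * y1 s) ∧ 0 < (∫ s in (0:ℝ)..T, y2 s * y2 s) ∧
    (∫ s in (0:ℝ)..T, y1 s * y2 s) ^ 2 <
      (∫ s in (0:ℝ)..T, y1 s * y1 s) * (∫ s in (0:ℝ)..T, y2 s * y2 s) := by
  have c1 := cont_of_hd F.h1
  have c2 := cont_of_hd F.h2
  have p1 : ∀ t : ℝ, 0 < ∫ s in (0:ℝ)..T, (y1 s + t * y2 s) * (y1 s + t * y2 s) := by
    intro t
    refine intervalIntegral.integral_pos hT (by fun_prop) (fun x _ => mul_self_nonneg _)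
      ⟨0, ⟨le_rfl, hT.le⟩, ?_⟩
    rw [F.i1, F.i2]; norm_num
  have p2 : 0 < (∫ s in (0:ℝ)..T, y2 s * y2 s) := by
    refine intervalIntegral.integral_pos hT (by fun_prop) (fun x _ => mul_self_nonneg _) ?_
    by_contra hcon
    push Not at hcon
    have hz : ∀ x ∈ Icc 0 T, y2 x = 0 := fun x hx => by
      have := hcon x hx
      nlinarith [mul_self_nonneg (y2 x)]
    have hm : T / 2 ∈ Ioo 0 T := ⟨by linarith, by linarith⟩
    have hev : y2 =ᶠ[nhds (T / 2)] fun _ => (0:ℝ) := by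
      filter_upwards [Ioo_mem_nhds hm.1 hm.2] with x hx
      exact hz x ⟨hx.1.le, hx.2.le⟩
    have h0 : y2d (T / 2) = 0 :=
      (F.h2 (T / 2)).unique ((hasDerivAt_const (T / 2) (0:ℝ)).congr_of_eventuallyEq hev)
    have := F.wronsk (T / 2)
    rw [h0, hz _ ⟨hm.1.le, hm.2.le⟩] at this
    norm_num at this
  have p3 := p1 0
  simp only [zero_mul, add_zero] at p3
  refine ⟨p3, p2, ?_⟩
  set I11 := ∫ s in (0:ℝ)..T, y1 s * y1 s
  set I22 := ∫ s in (0:ℝ)..T, y2 s * y2 s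
  set I12 := ∫ s in (0:ℝ)..T, y1 s * y2 s
  have ex : ∀ t : ℝ, ∫ s in (0:ℝ)..T, (y1 s + t * y2 s) * (y1 s + t * y2 s) =
      I11 + 2 * t * I12 + t ^ 2 * I22 := by
    intro t
    have : (fun s => (y1 s + t * y2 s) * (y1 s + t * y2 s)) =
      fun s => y1 s * y1 s + (2 * t) * (y1 s * y2 s) + t ^ 2 * (y2 s * y2 s) := by
      ext s; ring
    rw [this, intervalIntegral.integral_add, intervalIntegral.integral_add,
      intervalIntegral.integral_const_mul, intervalIntegral.integral_const_mul]
    all_goals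
      apply Continuous.intervalIntegrable
      fun_prop
  have h := p1 (-I12 / I22)
  rw [ex] at h
  have h2 : I11 + 2 * (-I12 / I22) * I12 + (-I12 / I22) ^ 2 * I22 = (I11 * I22 - I12 ^ 2) / I22 := by
    field_simp
    ring
  rw [h2] at h
  have := (div_pos_iff_of_pos_right p2).1 h
  linarith

theorem hill_edge {P : ℝ → ℝ} {y1 y1d y2 y2d : ℝ → ℝ → ℝ}
    (h : IsHillFundamental P y1 y1d y2 y2d) (hP : Continuous P) {T : ℝ} (hT : 0 < T) (Δ : ℝ → ℝ)
    (hΔ : Δ = fun ν => y1 ν T + y2d ν T) (a : ℝ) (h4 : Δ a ^ 2 = 4) (hd : deriv Δ a = 0) :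
    ∀ᶠ ν in nhdsWithin a {a}ᶜ, Δ ν ^ 2 < 4 := by
  have F := hill_fund h a
  obtain ⟨I1, I2, I3⟩ := F.int_facts hT
  obtain ⟨-, -, hform⟩ := hill_delta_smooth h hP T Δ hΔ
  obtain ⟨d1, d2, d3, d4⟩ := hill_real_deriv h hP a T
  have hf := hform a
  rw [hd] at hf
  have hsym : (∫ s in (0:ℝ)..T, y2 a s * y1 a s) = ∫ s in (0:ℝ)..T, y1 a s * y2 a s := by
    congr 1; ext s; ring
  simp only [VK, hsym] at hf d1 d2 d3 d4
  set I11 := ∫ s in (0:ℝ)..T, y1 a s * y1 a s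
  set I22 := ∫ s in (0:ℝ)..T, y2 a s * y2 a s
  set I12 := ∫ s in (0:ℝ)..T, y1 a s * y2 a s
  have w := F.wronsk T
  have w' : ∀ ν, y1 ν T * y2d ν T - y1d ν T * y2 ν T = 1 := fun ν => (hill_fund h ν).wronsk T
  have hid : ∀ ν, Δ ν ^ 2 - 4 = (y1 ν T - y2d ν T) ^ 2 + 4 * (y2 ν T * y1d ν T) := by
    intro ν
    rw [hΔ]
    linear_combination (4 : ℝ) * w' ν
  have hq := hid a
  rw [h4] at hq
  set A := y1 a T
  set B := y2 a T
  set C := y1d a T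
  set E := y2d a T
  -- B I11 + (E - A) I12 - C I22 = 0
  have hBC : B * C ≤ 0 := by nlinarith [sq_nonneg (A - E)]
  have hkey : (B * I11 - C * I22) ^ 2 = -4 * (B * C) * I12 ^ 2 := by
    have : B * I11 - C * I22 = (A - E) * I12 := by linear_combination - hf
    rw [this]
    linear_combination - I12 ^ 2 * hq
  have hBC0 : B * C = 0 := by
    by_contra hne
    have hlt : B * C < 0 := lt_of_le_of_ne hBC hne
    have : (B * I11 - C * I22) ^ 2 = (B * I11 + C * I22) ^ 2 - 4 * (B * C) * (I11 * I22) := by ring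
    nlinarith [sq_nonneg (B * I11 + C * I22)]
  have hsq : (B * I11 - C * I22) ^ 2 = 0 := by rw [hkey, hBC0]; ring
  have hlin : B * I11 = C * I22 := by
    have := pow_eq_zero_iff (two_ne_zero) |>.1 hsq
    linarith
  have hAE : A = E := by
    rw [hBC0] at hq
    have : (A - E) ^ 2 = 0 := by linarith
    have := pow_eq_zero_iff (two_ne_zero) |>.1 this
    linarith
  have hB : B = 0 := by
    rcases mul_eq_zero.1 hBC0 with h | h
    · exact h
    · rw [h] at hlin
      have : B * I11 = 0 := by linarith
      exact (mul_eq_zero.1 this).resolve_right I1.ne'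
  have hC : C = 0 := by
    rw [hB] at hlin
    have : C * I22 = 0 := by linarith
    exact (mul_eq_zero.1 this).resolve_right I2.ne'
  have hA2 : A ^ 2 = 1 := by
    rw [hB, hC, ← hAE] at w
    linarith
  have s1 := hasDerivAt_iff_tendsto_slope.1 (d1.sub d4)
  have s2 := hasDerivAt_iff_tendsto_slope.1 d2
  have s3 := hasDerivAt_iff_tendsto_slope.1 d3
  have lim := (s1.pow 2).add (((s3.mul s2)).const_mul 4)
  have hneg : (B * I11 - A * I12 - (E * I12 - C * I22)) ^ 2 +
      4 * ((B * I12 - A * I22) * (E * I11 - C * I12)) < 0 := by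
    rw [hB, hC, ← hAE]
    have : (0 * I11 - A * I12 - (A * I12 - 0 * I22)) ^ 2 +
      4 * ((0 * I12 - A * I22) * (A * I11 - 0 * I12)) = 4 * A ^ 2 * (I12 ^ 2 - I11 * I22) := by ring
    rw [this, hA2]
    linarith
  have ev := lim.eventually_lt_const hneg
  filter_upwards [ev, self_mem_nhdsWithin] with ν hν hne
  have hne' : ν - a ≠ 0 := sub_ne_zero.2 hne
  simp only [slope_def_field, Pi.sub_apply] at hν
  change ((y1 ν T - y2d ν T - (A - E)) / (ν - a)) ^ 2 +
    4 * ((y2 ν T - B) / (ν - a) * ((y1d ν T - C) / (ν - a))) < 0 at hν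
  rw [hB, hC, ← hAE] at hν
  have e : ((y1 ν T - y2d ν T - (A - A)) / (ν - a)) ^ 2 +
    4 * ((y2 ν T - 0) / (ν - a) * ((y1d ν T - 0) / (ν - a))) = (Δ ν ^ 2 - 4) / (ν - a) ^ 2 := by
    rw [hid ν]
    field_simp
    ring
  rw [e] at hν
  have := (div_neg_iff.1 hν)
  have hp : 0 < (ν - a) ^ 2 := by positivity
  rcases this with h | h
  · linarith [h.2]
  · linarith [h.1]


theorem edge_left {g : ℝ → ℝ} {g' a b : ℝ} (hg : HasDerivAt g g' a) (hne : g' ≠ 0) (ha : g a = 4)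
    (hab : a < b) (hgap : ∀ ν ∈ Ioo a b, g ν > 4) : ∀ᶠ ν in nhdsWithin a (Iio a), g ν < 4 := by
  have s := hasDerivAt_iff_tendsto_slope.1 hg
  have s1 : Tendsto (slope g a) (nhdsWithin a (Ioi a)) (nhds g') :=
    s.mono_left (nhdsWithin_mono _ fun x hx => (ne_of_gt hx))
  have h0 : 0 ≤ g' := by
    refine ge_of_tendsto s1 ?_
    filter_upwards [Ioo_mem_nhdsGT hab] with ν hν
    rw [slope_def_field, ha]
    exact div_nonneg (by linarith [hgap ν hν]) (by linarith [hν.1])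
  have hpos : 0 < g' := lt_of_le_of_ne h0 hne.symm
  have s2 : Tendsto (slope g a) (nhdsWithin a (Iio a)) (nhds g') :=
    s.mono_left (nhdsWithin_mono _ fun x hx => (ne_of_lt hx))
  filter_upwards [s2.eventually_const_lt hpos, self_mem_nhdsWithin] with ν hν hlt
  rw [slope_def_field, ha] at hν
  have hlt' : ν - a < 0 := sub_neg.2 hlt
  rcases div_pos_iff.1 hν with h | h
  · linarith [h.2]
  · linarith [h.1]

theorem gap_left {D D' G : ℝ → ℝ} (hD : ∀ ν, HasDerivAt D (D' ν) ν) (hG : Continuous G)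
    {m a : ℝ} (hma : m < a) (hm : D m = 0) (ha : D a ^ 2 = 4)
    (hnear : ∀ᶠ ν in nhdsWithin a (Iio a), D ν ^ 2 < 4) (hGa : G a < 0)
    (hz : ∀ ν ∈ Ico m a, D ν = 0 → 0 < G ν)
    (hcrit : ∀ ν ∈ Ico m a, D' ν = 0 → D ν ^ 2 < 4 → 0 < G ν) :
    ∃ ν ∈ Ioo m a, D ν ^ 2 < 4 ∧ G ν = 0 := by
  have cD : Continuous D := continuous_iff_continuousAt.2 fun z => (hD z).continuousAt
  have hne : ∀ᶠ ν in nhdsWithin a (Iio a), D ν ≠ 0 := by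
    apply mem_nhdsWithin_of_mem_nhds
    have : D a ≠ 0 := by
      intro h; rw [h] at ha; norm_num at ha
    exact cD.continuousAt.eventually_ne this
  have hboth := (hnear.and hne).and (Ioo_mem_nhdsLT hma)
  obtain ⟨l, hl, hsub⟩ := (mem_nhdsLT_iff_exists_Ioo_subset).1 hboth
  have hl : l < a := hl
  set x0 := (max l m + a) / 2 with hx0
  have hmax : max l m < a := max_lt hl hma
  have hx0a : x0 < a := by rw [hx0]; linarith
  have hlx0 : l < x0 := by rw [hx0]; linarith [le_max_left l m]
  have hmx0 : m < x0 := by rw [hx0]; linarith [le_max_right l m]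
  have hScl : IsCompact (Icc m x0 ∩ {ν | 4 ≤ D ν ^ 2 ∨ D ν = 0}) := by
    refine isCompact_Icc.inter_right ?_
    exact (isClosed_le continuous_const (cD.pow 2)).union (isClosed_eq cD continuous_const)
  obtain ⟨e, ⟨⟨hme, hex⟩, hbad⟩, hgr⟩ := hScl.exists_isGreatest
    ⟨m, ⟨le_rfl, hmx0.le⟩, Or.inr hm⟩
  have hea : e < a := lt_of_le_of_lt hex hx0a
  have good : ∀ ν ∈ Ioo e a, D ν ^ 2 < 4 ∧ D ν ≠ 0 := by
    intro ν hν
    rcases le_or_gt ν x0 with h | h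
    · by_contra hcon
      have : ν ∈ Icc m x0 ∩ {ν | 4 ≤ D ν ^ 2 ∨ D ν = 0} := by
        refine ⟨⟨hme.trans hν.1.le, h⟩, ?_⟩
        rw [mem_ofPred_eq]
        by_contra hc
        push Not at hc
        exact hcon hc
      exact absurd (hgr this) (not_le.2 hν.1)
    · exact (hsub ⟨hlx0.trans h, hν.2⟩).1
  have fin : ∀ p ∈ Ico e a, (D p ^ 2 < 4) → 0 < G p → ∃ ν ∈ Ioo m a, D ν ^ 2 < 4 ∧ G ν = 0 := by
    intro p hp hp4 hGp
    obtain ⟨ν, hν, hν0⟩ := intermediate_value_Ioo' hp.2.le hG.continuousOn ⟨hGa, hGp⟩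
    have h1 : e < ν := lt_of_le_of_lt hp.1 hν.1
    exact ⟨ν, ⟨lt_of_le_of_lt hme h1, hν.2⟩, (good ν ⟨h1, hν.2⟩).1, hν0⟩
  by_cases h0 : D e = 0
  · exact fin e ⟨le_rfl, hea⟩ (by rw [h0]; norm_num) (hz e ⟨hme, hea⟩ h0)
  · have h4 : 4 ≤ D e ^ 2 := hbad.resolve_right h0
    have h4' : D e ^ 2 ≤ 4 := by
      have t : Tendsto (fun ν => D ν ^ 2) (nhdsWithin e (Ioi e)) (nhds (D e ^ 2)) :=
        ((cD.pow 2).tendsto e).mono_left nhdsWithin_le_nhds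
      refine le_of_tendsto t ?_
      filter_upwards [Ioo_mem_nhdsGT hea] with ν hν
      exact (good ν hν).1.le
    obtain ⟨p, hp, hp0⟩ := exists_hasDerivAt_eq_zero hea ((cD.pow 2).continuousOn)
      (f' := fun ν => 2 * D ν ^ 1 * D' ν) (by rw [Pi.pow_apply, Pi.pow_apply, ha]; linarith) (fun x _ => by simpa using (hD x).pow 2)
    have hD0 : D' p = 0 := by
      have := (good p hp).2
      simpa [this] using hp0
    exact fin p ⟨hp.1.le, hp.2⟩ (good p hp).1 (hcrit p ⟨hme.trans hp.1.le, hp.2⟩ hD0 (good p hp).1)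

theorem hd_comp_neg {g : ℝ → ℝ} {g' : ℝ} (x : ℝ) (h : HasDerivAt g g' (-x)) :
    HasDerivAt (fun x => g (-x)) (-g') x := by
  have := h.comp x (hasDerivAt_neg x)
  simpa [Function.comp_def] using this

theorem gap_right {D D' G : ℝ → ℝ} (hD : ∀ ν, HasDerivAt D (D' ν) ν) (hG : Continuous G)
    {m b : ℝ} (hma : b < m) (hm : D m = 0) (ha : D b ^ 2 = 4)
    (hnear : ∀ᶠ ν in nhdsWithin b (Ioi b), D ν ^ 2 < 4) (hGa : G b < 0)
    (hz : ∀ ν ∈ Ioc b m, D ν = 0 → 0 < G ν)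
    (hcrit : ∀ ν ∈ Ioc b m, D' ν = 0 → D ν ^ 2 < 4 → 0 < G ν) :
    ∃ ν ∈ Ioo b m, D ν ^ 2 < 4 ∧ G ν = 0 := by
  obtain ⟨ν, hν, h1, h2⟩ := gap_left (D := fun x => D (-x)) (D' := fun x => - D' (-x))
    (G := fun x => G (-x)) (m := -m) (a := -b)
    (fun ν => hd_comp_neg ν (hD (-ν))) (hG.comp continuous_neg) (by linarith)
    (by simpa using hm) (by simpa using ha) (by
      have : Tendsto (fun x : ℝ => -x) (nhdsWithin (-b) (Iio (-b))) (nhdsWithin b (Ioi b)) := by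
        simpa using tendsto_neg_nhdsLT (a := -b)
      exact this.eventually hnear) (by simpa using hGa)
    (fun ν hν h => hz (-ν) ⟨by linarith [hν.2], by linarith [hν.1]⟩ h)
    (fun ν hν h h' => hcrit (-ν) ⟨by linarith [hν.2], by linarith [hν.1]⟩ (by linarith) h')
  exact ⟨-ν, ⟨by linarith [hν.2], by linarith [hν.1]⟩, h1, h2⟩

theorem edge_right {g : ℝ → ℝ} {g' a b : ℝ} (hg : HasDerivAt g g' b) (hne : g' ≠ 0) (hb : g b = 4)
    (hab : a < b) (hgap : ∀ ν ∈ Ioo a b, g ν > 4) : ∀ᶠ ν in nhdsWithin b (Ioi b), g ν < 4 := by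
  have := edge_left (g := fun x => g (-x)) (g' := -g') (a := -b) (b := -a)
    (hd_comp_neg (-b) (by simpa using hg)) (by simpa using hne) (by simpa using hb)
    (by linarith) (fun ν hν => hgap (-ν) ⟨by linarith [hν.2], by linarith [hν.1]⟩)
  have t : Tendsto (fun x : ℝ => -x) (nhdsWithin b (Ioi b)) (nhdsWithin (-b) (Iio (-b))) :=
    tendsto_neg_nhdsGT
  simpa using t.eventually this


theorem osc {P y yd : ℝ → ℝ} {T C k : ℝ} (hT : 0 < T) (hC : 0 ≤ C) (hk : 1 ≤ k)
    (hPC : ∀ z ∈ Icc 0 T, |P z| ≤ C)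
    (hy : ∀ z, HasDerivAt y (yd z) z) (hyd : ∀ z, HasDerivAt yd ((-k ^ 2 - P z) * y z) z)
    (h0 : y 0 ^ 2 + (yd 0 / k) ^ 2 = 1) :
    ∀ z ∈ Icc 0 T,
      |y z - (y 0 * cos (k * z) + (yd 0 / k) * sin (k * z))| ≤ 2 * (C * exp (C * T) * T) / k ∧
      |yd z / k - (-(y 0 * sin (k * z)) + (yd 0 / k) * cos (k * z))| ≤
        2 * (C * exp (C * T) * T) / k := by
  have hk0 : 0 < k := by linarith
  have hE : ∀ z, HasDerivAt (fun z => exp (-C * z) * (y z ^ 2 + (yd z / k) ^ 2))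
      (exp (-C * z) * (-2 * P z * y z * (yd z / k) / k - C * (y z ^ 2 + (yd z / k) ^ 2))) z := by
    intro z
    have e1 : HasDerivAt (fun z => exp (-C * z)) (exp (-C * z) * (-C)) z := by
      simpa using ((hasDerivAt_id z).const_mul (-C)).exp
    have e2 := (((hy z).pow 2).add (((hyd z).div_const k).pow 2))
    convert! e1.mul e2 using 1
    simp only [Pi.add_apply, Pi.pow_apply, show (2 : ℕ) - 1 = 1 from rfl, pow_one, Nat.cast_ofNat]
    field_simp
    ring
  have hanti : AntitoneOn (fun z => exp (-C * z) * (y z ^ 2 + (yd z / k) ^ 2)) (Icc 0 T) := by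
    refine antitoneOn_of_deriv_nonpos (convex_Icc _ _)
      (fun z _ => (hE z).continuousAt.continuousWithinAt)
      (fun z _ => (hE z).differentiableAt.differentiableWithinAt) ?_
    intro z hz
    rw [interior_Icc] at hz
    rw [(hE z).deriv]
    refine mul_nonpos_of_nonneg_of_nonpos (exp_pos _).le ?_
    have hp := abs_le.1 (hPC z ⟨hz.1.le, hz.2.le⟩)
    set u := y z
    set v := yd z / k
    have h1 : |P z * (2 * u * v)| ≤ C * (u ^ 2 + v ^ 2) := by
      rw [abs_mul]
      have : |2 * u * v| ≤ u ^ 2 + v ^ 2 := by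
        rw [abs_le]; constructor <;> nlinarith [sq_nonneg (u + v), sq_nonneg (u - v)]
      exact mul_le_mul (hPC z ⟨hz.1.le, hz.2.le⟩) this (abs_nonneg _) hC
    have h2 : -2 * P z * u * v / k ≤ C * (u ^ 2 + v ^ 2) := by
      calc -2 * P z * u * v / k ≤ |-2 * P z * u * v / k| := le_abs_self _
        _ = |P z * (2 * u * v)| / k := by
            rw [abs_div, abs_of_pos hk0, ← abs_neg]; congr 2; ring
        _ ≤ |P z * (2 * u * v)| := div_le_self (abs_nonneg _) hk
        _ ≤ _ := h1
    linarith
  have hbd : ∀ z ∈ Icc 0 T, |y z| ≤ exp (C * T) := by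
    intro z hz
    have h1 := hanti (left_mem_Icc.2 hT.le) hz hz.1
    simp only [mul_zero, exp_zero, one_mul, h0] at h1
    have h2 : y z ^ 2 + (yd z / k) ^ 2 ≤ exp (C * z) := by
      have := mul_le_mul_of_nonneg_left h1 (exp_pos (C * z)).le
      rw [← mul_assoc, ← exp_add] at this
      simpa using this
    have h3 : exp (C * z) ≤ exp (C * T) := exp_le_exp.2 (mul_le_mul_of_nonneg_left hz.2 hC)
    have h4 : 1 ≤ exp (C * T) := one_le_exp (by positivity)
    refine abs_le_of_sq_le_sq ?_ (exp_pos _).le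
    nlinarith [sq_nonneg (yd z / k)]
  have hc : ∀ z, HasDerivAt (fun z => cos (k * z)) (-sin (k * z) * k) z := by
    intro z
    simpa using ((hasDerivAt_id z).const_mul k).cos
  have hs : ∀ z, HasDerivAt (fun z => sin (k * z)) (cos (k * z) * k) z := by
    intro z
    simpa using ((hasDerivAt_id z).const_mul k).sin
  have hp : ∀ z, HasDerivAt (fun z => y z * cos (k * z) - yd z / k * sin (k * z))
      (P z * y z / k * sin (k * z)) z := by
    intro z
    convert! ((hy z).mul (hc z)).sub (((hyd z).div_const k).mul (hs z)) using 1
    field_simp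
    ring
  have hq : ∀ z, HasDerivAt (fun z => y z * sin (k * z) + yd z / k * cos (k * z))
      (-(P z * y z / k * cos (k * z))) z := by
    intro z
    convert! ((hy z).mul (hs z)).add (((hyd z).div_const k).mul (hc z)) using 1
    field_simp
    ring
  have hb2 : ∀ z ∈ Icc 0 T, |P z * y z / k| ≤ C * exp (C * T) / k := by
    intro z hz
    rw [abs_div, abs_of_pos hk0, abs_mul]
    gcongr
    · exact hPC z hz
    · exact hbd z hz
  have hbpos : 0 ≤ C * exp (C * T) / k := by positivity
  have dp : ∀ z ∈ Icc 0 T, |(y z * cos (k * z) - yd z / k * sin (k * z)) - y 0| ≤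
      C * exp (C * T) * T / k := by
    intro z hz
    have := (convex_Icc 0 T).norm_image_sub_le_of_norm_hasDerivWithin_le
      (fun x _ => (hp x).hasDerivWithinAt) (C := C * exp (C * T) / k) (fun x hx => by
        rw [Real.norm_eq_abs, abs_mul]
        calc |P x * y x / k| * |sin (k * x)| ≤ C * exp (C * T) / k * 1 :=
              mul_le_mul (hb2 x hx) (abs_sin_le_one _) (abs_nonneg _) hbpos
          _ = _ := mul_one _) (left_mem_Icc.2 hT.le) hz
    simp only [mul_zero, cos_zero, sin_zero, mul_one, sub_zero, Real.norm_eq_abs] at this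
    refine this.trans ?_
    rw [abs_of_nonneg hz.1]
    calc C * exp (C * T) / k * z ≤ C * exp (C * T) / k * T := by gcongr; exact hz.2
      _ = _ := by ring
  have dq : ∀ z ∈ Icc 0 T, |(y z * sin (k * z) + yd z / k * cos (k * z)) - yd 0 / k| ≤
      C * exp (C * T) * T / k := by
    intro z hz
    have := (convex_Icc 0 T).norm_image_sub_le_of_norm_hasDerivWithin_le
      (fun x _ => (hq x).hasDerivWithinAt) (C := C * exp (C * T) / k) (fun x hx => by
        rw [Real.norm_eq_abs, abs_neg, abs_mul]
        calc |P x * y x / k| * |cos (k * x)| ≤ C * exp (C * T) / k * 1 :=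
              mul_le_mul (hb2 x hx) (abs_cos_le_one _) (abs_nonneg _) hbpos
          _ = _ := mul_one _) (left_mem_Icc.2 hT.le) hz
    simp only [mul_zero, cos_zero, sin_zero, mul_one, sub_zero, zero_add, Real.norm_eq_abs] at this
    refine this.trans ?_
    rw [abs_of_nonneg hz.1]
    calc C * exp (C * T) / k * z ≤ C * exp (C * T) / k * T := by gcongr; exact hz.2
      _ = _ := by ring
  intro z hz
  have a1 := dp z hz
  have a2 := dq z hz
  set dP := (y z * cos (k * z) - yd z / k * sin (k * z)) - y 0 with hdP
  set dQ := (y z * sin (k * z) + yd z / k * cos (k * z)) - yd 0 / k with hdQ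
  have cs := sin_sq_add_cos_sq (k * z)
  have comb : ∀ r t : ℝ, |r| ≤ 1 → |t| ≤ 1 → |dP * r + dQ * t| ≤ 2 * (C * exp (C * T) * T) / k := by
    intro r t hr ht
    calc |dP * r + dQ * t| ≤ |dP| * |r| + |dQ| * |t| := by
          rw [← abs_mul, ← abs_mul]; exact abs_add_le _ _
      _ ≤ |dP| * 1 + |dQ| * 1 := by gcongr
      _ ≤ _ := by rw [mul_div_assoc]; linarith
  constructor
  · have e : y z - (y 0 * cos (k * z) + (yd 0 / k) * sin (k * z)) =
        dP * cos (k * z) + dQ * sin (k * z) := by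
      rw [hdP, hdQ]; linear_combination (- y z) * cs
    rw [e]
    exact comb _ _ (abs_cos_le_one _) (abs_sin_le_one _)
  · have e : yd z / k - (-(y 0 * sin (k * z)) + (yd 0 / k) * cos (k * z)) =
        dP * (-sin (k * z)) + dQ * cos (k * z) := by
      rw [hdP, hdQ]; linear_combination (- (yd z / k)) * cs
    rw [e]
    exact comb _ _ (by rw [abs_neg]; exact abs_sin_le_one _) (abs_cos_le_one _)

theorem hill_asymp {P : ℝ → ℝ} {y1 y1d y2 y2d : ℝ → ℝ → ℝ}
    (h : IsHillFundamental P y1 y1d y2 y2d) (hP : Continuous P) {T : ℝ} (hT : 0 < T) :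
    ∃ K : ℝ, 0 ≤ K ∧ ∀ k : ℝ, 1 ≤ k → ∀ z ∈ Icc 0 T,
      |y1 (-k ^ 2) z - cos (k * z)| ≤ K / k ∧ |y1d (-k ^ 2) z / k + sin (k * z)| ≤ K / k ∧
      |k * y2 (-k ^ 2) z - sin (k * z)| ≤ K / k ∧ |y2d (-k ^ 2) z - cos (k * z)| ≤ K / k := by
  obtain ⟨C, hC, hb⟩ := exists_bound hP T
  refine ⟨2 * (C * exp (C * T) * T), by positivity, fun k hk z hz => ?_⟩
  have hk0 : 0 < k := by linarith
  have F := hill_fund h (-k ^ 2)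
  have hPC : ∀ z ∈ Icc 0 T, |P z| ≤ C := fun z hz => hb z (by rw [abs_of_nonneg hz.1]; exact hz.2)
  have o1 := osc hT hC hk hPC F.h1 F.h1d (by rw [F.i1, F.i1d]; simp) z hz
  have o2 := osc (y := fun z => k * y2 (-k ^ 2) z) (yd := fun z => k * y2d (-k ^ 2) z)
    hT hC hk hPC (fun z => (F.h2 z).const_mul k) (fun z => by
      convert! (F.h2d z).const_mul k using 1
      ring) (by rw [F.i2, F.i2d]; field_simp; simp) z hz
  simp only [F.i1, F.i1d, F.i2, F.i2d] at o1 o2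
  refine ⟨?_, ?_, ?_, ?_⟩
  · simpa using o1.1
  · simpa using o1.2
  · simpa [hk0.ne'] using o2.1
  · have e : k * y2d (-k ^ 2) z / k = y2d (-k ^ 2) z := by field_simp
    have := o2.2
    rw [e] at this
    simpa [hk0.ne'] using this

theorem hill_zeros {P : ℝ → ℝ} {y1 y1d y2 y2d : ℝ → ℝ → ℝ}
    (h : IsHillFundamental P y1 y1d y2 y2d) (hP : Continuous P) {T : ℝ} (hT : 0 < T) (Δ : ℝ → ℝ)
    (hΔ : Δ = fun ν => y1 ν T + y2d ν T) (M : ℝ) : ∃ m < M, Δ m = 0 := by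
  obtain ⟨K, hK, hasy⟩ := hill_asymp h hP hT
  have hcont : Continuous Δ := by
    obtain ⟨hd, -, -⟩ := hill_delta_smooth h hP T Δ hΔ
    exact continuous_iff_continuousAt.2 fun z => (hd z).continuousAt
  have happ : ∀ k : ℝ, 1 ≤ k → |Δ (-k ^ 2) - 2 * cos (k * T)| ≤ 2 * (K / k) := by
    intro k hk
    obtain ⟨a1, -, -, a4⟩ := hasy k hk T (right_mem_Icc.2 hT.le)
    have : Δ (-k ^ 2) - 2 * cos (k * T) = (y1 (-k ^ 2) T - cos (k * T)) + (y2d (-k ^ 2) T - cos (k * T)) := by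
      rw [hΔ]; ring
    rw [this]
    refine (abs_add_le _ _).trans (by linarith)
  obtain ⟨n, hn⟩ := exists_nat_gt ((1 + K + |M|) * T)
  set k := n * (2 * π) / T with hk
  have hkb : 1 + K + |M| < k := by
    rw [hk, lt_div_iff₀ hT]
    have : (n : ℝ) * 1 ≤ n * (2 * π) := by
      gcongr
      linarith [pi_gt_three]
    linarith
  have hMp := abs_nonneg M
  set k' := k + π / T with hk'
  have hkk' : k < k' := by
    have : 0 < π / T := by positivity
    linarith
  have c1 : cos (k * T) = 1 := by
    rw [hk, div_mul_cancel₀ _ hT.ne']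
    exact cos_nat_mul_two_pi n
  have c2 : cos (k' * T) = -1 := by
    rw [hk', add_mul, div_mul_cancel₀ π hT.ne', cos_add_pi, c1]
  have p1 := happ k (by linarith)
  have p2 := happ k' (by linarith)
  rw [c1] at p1
  rw [c2] at p2
  have q1 : K / k < 1 := (div_lt_one (by linarith)).2 (by linarith)
  have q2 : K / k' < 1 := (div_lt_one (by linarith)).2 (by linarith)
  have r1 : 0 < Δ (-k ^ 2) := by linarith [(abs_le.1 p1).1]
  have r2 : Δ (-k' ^ 2) < 0 := by linarith [(abs_le.1 p2).2]
  have hle : -k' ^ 2 ≤ -k ^ 2 := by nlinarith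
  obtain ⟨m, hm, hm0⟩ := intermediate_value_Icc hle hcont.continuousOn ⟨r2.le, r1.le⟩
  refine ⟨m, ?_, hm0⟩
  have : -k ^ 2 < M := by nlinarith [neg_abs_le M]
  linarith [hm.2]

set_option maxHeartbeats 1600000 in
theorem hill_deriv_bound {P : ℝ → ℝ} {y1 y1d y2 y2d : ℝ → ℝ → ℝ}
    (h : IsHillFundamental P y1 y1d y2 y2d) (hP : Continuous P) {T : ℝ} (hT : 0 < T) (Δ : ℝ → ℝ)
    (hΔ : Δ = fun ν => y1 ν T + y2d ν T) {c : ℝ} (hc : 1 < c ^ 2) :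
    ∃ N : ℝ, 0 < N ∧ ∀ ν < -N, (-ν) * (deriv Δ ν) ^ 2 < c ^ 2 * T ^ 2 := by
  obtain ⟨K, hK, hasy⟩ := hill_asymp h hP hT
  obtain ⟨-, -, hform⟩ := hill_delta_smooth h hP T Δ hΔ
  have hc1 : 1 < |c| := by rw [← sq_lt_sq₀ (by norm_num) (abs_nonneg _), sq_abs]; simpa using hc
  set k0 := 1 + K + 22 * K / (|c| - 1) with hk0
  have hk0' : 0 ≤ 22 * K / (|c| - 1) := div_nonneg (by positivity) (by linarith)
  refine ⟨k0 ^ 2, by positivity, fun ν hν => ?_⟩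
  set k := √(-ν) with hk
  have hkpos : k0 < k := by
    rw [hk]; exact Real.lt_sqrt_of_sq_lt (by linarith)
  have hk1 : 1 ≤ k := by linarith
  have hkp : 0 < k := by linarith
  have hν2 : -ν = k ^ 2 := by rw [hk, Real.sq_sqrt]; nlinarith
  have hν3 : ν = -k ^ 2 := by linarith
  have has := hasy k hk1
  rw [← hν3] at has
  set ε := K / k with hε
  have hε0 : 0 ≤ ε := by positivity
  have hε1 : ε ≤ 1 := (div_le_one hkp).2 (by linarith)
  have hε2 : 22 * ε < |c| - 1 := by
    rw [hε, ← mul_div_assoc, div_lt_iff₀ hkp]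
    have : 22 * K / (|c| - 1) < k := by linarith
    rw [div_lt_iff₀ (by linarith)] at this
    linarith
  have F := hill_fund h ν
  have c1 := cont_of_hd F.h1
  have c2 := cont_of_hd F.h2
  have pt : ∀ z ∈ Icc 0 T, |y1 ν z| ≤ 2 ∧ |k * y2 ν z| ≤ 2 ∧
      y1 ν z ^ 2 + (k * y2 ν z) ^ 2 ≤ 1 + 6 * ε := by
    intro z hz
    obtain ⟨a1, -, a3, -⟩ := has z hz
    have cs := sin_sq_add_cos_sq (k * z)
    have k1 := abs_cos_le_one (k * z)
    have k2 := abs_sin_le_one (k * z)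
    set η1 := y1 ν z - cos (k * z) with h1
    set η2 := k * y2 ν z - sin (k * z) with h2
    have e1 : y1 ν z = cos (k * z) + η1 := by rw [h1]; ring
    have e2 : k * y2 ν z = sin (k * z) + η2 := by rw [h2]; ring
    rw [e1, e2]
    refine ⟨(abs_add_le _ _).trans (by linarith), (abs_add_le _ _).trans (by linarith), ?_⟩
    have f1 : η1 * cos (k * z) ≤ ε := by
      calc _ ≤ |η1 * cos (k * z)| := le_abs_self _
        _ = |η1| * |cos (k * z)| := abs_mul _ _
        _ ≤ ε * 1 := mul_le_mul a1 k1 (abs_nonneg _) hε0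
        _ = ε := mul_one _
    have f2 : η2 * sin (k * z) ≤ ε := by
      calc _ ≤ |η2 * sin (k * z)| := le_abs_self _
        _ = |η2| * |sin (k * z)| := abs_mul _ _
        _ ≤ ε * 1 := mul_le_mul a3 k2 (abs_nonneg _) hε0
        _ = ε := mul_one _
    have f3 : η1 ^ 2 ≤ ε := by
      have : η1 ^ 2 ≤ ε ^ 2 := sq_le_sq' (by linarith [(abs_le.1 a1).1]) (abs_le.1 a1).2
      nlinarith
    have f4 : η2 ^ 2 ≤ ε := by
      have : η2 ^ 2 ≤ ε ^ 2 := sq_le_sq' (by linarith [(abs_le.1 a3).1]) (abs_le.1 a3).2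
      nlinarith
    nlinarith
  have hsym : (∫ s in (0:ℝ)..T, y2 ν s * y1 ν s) = ∫ s in (0:ℝ)..T, y1 ν s * y2 ν s := by
    congr 1; ext s; ring
  have hf := hform ν
  simp only [VK, hsym] at hf
  set J11 := ∫ s in (0:ℝ)..T, y1 ν s * y1 ν s with hJ11
  set J22 := ∫ s in (0:ℝ)..T, y2 ν s * y2 ν s with hJ22
  set J12 := ∫ s in (0:ℝ)..T, y1 ν s * y2 ν s with hJ12
  have nb : ∀ (g : ℝ → ℝ) (B : ℝ), (∀ z ∈ Icc 0 T, |g z| ≤ B) → |∫ s in (0:ℝ)..T, g s| ≤ B * T := by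
    intro g B hg
    have := intervalIntegral.norm_integral_le_of_norm_le_const (a := 0) (b := T) (f := g) (C := B)
      (fun x hx => by
        rw [uIoc_of_le hT.le] at hx
        exact hg x ⟨hx.1.le, hx.2⟩)
    simpa [abs_of_pos hT] using this
  have b11 : |J11| ≤ 4 * T := by
    apply nb
    intro z hz
    obtain ⟨q1, q2, -⟩ := pt z hz
    rw [abs_mul]
    nlinarith [abs_nonneg (y1 ν z)]
  have b22 : |k ^ 2 * J22| ≤ 4 * T := by
    rw [hJ22, ← intervalIntegral.integral_const_mul]
    apply nb
    intro z hz
    obtain ⟨q1, q2, -⟩ := pt z hz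
    rw [show k ^ 2 * (y2 ν z * y2 ν z) = (k * y2 ν z) * (k * y2 ν z) by ring, abs_mul]
    nlinarith [abs_nonneg (k * y2 ν z)]
  have b12 : |k * J12| ≤ 4 * T := by
    rw [hJ12, ← intervalIntegral.integral_const_mul]
    apply nb
    intro z hz
    obtain ⟨q1, q2, -⟩ := pt z hz
    rw [show k * (y1 ν z * y2 ν z) = (y1 ν z) * (k * y2 ν z) by ring, abs_mul]
    nlinarith [abs_nonneg (k * y2 ν z), abs_nonneg (y1 ν z)]
  have bsum : |J11 + k ^ 2 * J22| ≤ (1 + 6 * ε) * T := by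
    rw [hJ11, hJ22, ← intervalIntegral.integral_const_mul, ← intervalIntegral.integral_add
      (by apply Continuous.intervalIntegrable; fun_prop)
      (by apply Continuous.intervalIntegrable; fun_prop)]
    apply nb
    intro z hz
    obtain ⟨-, -, q3⟩ := pt z hz
    rw [show y1 ν z * y1 ν z + k ^ 2 * (y2 ν z * y2 ν z) = y1 ν z ^ 2 + (k * y2 ν z) ^ 2 by ring,
      abs_of_nonneg (by positivity)]
    exact q3
  obtain ⟨a1, a2, a3, a4⟩ := has T (right_mem_Icc.2 hT.le)
  set S := sin (k * T)
  set Cc := cos (k * T)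
  have k2 : |S| ≤ 1 := abs_sin_le_one _
  have eq : k * deriv Δ ν = S * (J11 + k ^ 2 * J22) + (k * y2 ν T - S) * J11
      + ((y2d ν T - Cc) - (y1 ν T - Cc)) * (k * J12) - (y1d ν T / k + S) * (k ^ 2 * J22) := by
    rw [hf]
    field_simp
    ring
  have bound : |k * deriv Δ ν| ≤ (1 + 22 * ε) * T := by
    rw [eq]
    have t1 : |S * (J11 + k ^ 2 * J22)| ≤ 1 * ((1 + 6 * ε) * T) := by
      rw [abs_mul]; exact mul_le_mul k2 bsum (abs_nonneg _) (by norm_num)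
    have t2 : |(k * y2 ν T - S) * J11| ≤ ε * (4 * T) := by
      rw [abs_mul]; exact mul_le_mul a3 b11 (abs_nonneg _) hε0
    have t3 : |((y2d ν T - Cc) - (y1 ν T - Cc)) * (k * J12)| ≤ (2 * ε) * (4 * T) := by
      rw [abs_mul]
      exact mul_le_mul ((abs_sub _ _).trans (by linarith)) b12 (abs_nonneg _) (by linarith)
    have t4 : |(y1d ν T / k + S) * (k ^ 2 * J22)| ≤ ε * (4 * T) := by
      rw [abs_mul]; exact mul_le_mul a2 b22 (abs_nonneg _) hε0
    refine (abs_sub _ _).trans ?_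
    have := abs_add_three (S * (J11 + k ^ 2 * J22)) ((k * y2 ν T - S) * J11)
      (((y2d ν T - Cc) - (y1 ν T - Cc)) * (k * J12))
    linarith
  have lt : |k * deriv Δ ν| < |c * T| := by
    rw [abs_mul c, abs_of_pos hT]
    refine lt_of_le_of_lt bound ?_
    have : 1 + 22 * ε < |c| := by linarith
    gcongr
  rw [hν2]
  have := sq_lt_sq.2 lt
  nlinarith


theorem off_axis {h : ℂ → ℂ} {l0 : ℂ} (ha : AnalyticAt ℂ h l0) (h0 : h l0 = 0)
    (h1 : deriv h l0 = 0) {U : Set ℂ} (hU : U ∈ nhds l0) :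
    ∃ l ∈ U, l0.re < l.re ∧ (h l).re = 0 := by
  by_cases hz : ∀ᶠ z in nhds l0, h z = 0
  · obtain ⟨ε, hε, hsub⟩ := Metric.mem_nhds_iff.1 (inter_mem hU hz)
    have hm : l0 + ((ε / 2 : ℝ) : ℂ) ∈ Metric.ball l0 ε := by
      rw [Metric.mem_ball, dist_eq_norm, add_sub_cancel_left, Complex.norm_real, Real.norm_eq_abs,
        abs_of_pos (by positivity)]
      linarith
    refine ⟨_, (hsub hm).1, ?_, ?_⟩
    · simp only [Complex.add_re, Complex.ofReal_re]; linarith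
    · have : h (l0 + ((ε / 2 : ℝ) : ℂ)) = 0 := (hsub hm).2
      rw [this]; simp
  · obtain ⟨n, g, hg, hg0, heq⟩ := (ha.exists_eventuallyEq_pow_smul_nonzero_iff).2 hz
    have hn0 : n ≠ 0 := by
      rintro rfl
      have := heq.self_of_nhds
      rw [h0] at this
      simp at this
      exact hg0 this.symm
    have hn1 : n ≠ 1 := by
      rintro rfl
      have hd : HasDerivAt (fun z => (z - l0) ^ 1 • g z) (g l0) l0 := by
        have := ((hasDerivAt_id l0).sub_const l0).mul hg.differentiableAt.hasDerivAt
        convert! this using 1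
        · ext z; simp
        · simp
      have hd2 := hd.congr_of_eventuallyEq heq
      rw [hd2.deriv] at h1
      exact hg0 h1
    have hn2 : 2 ≤ n := by omega
    have hnR : (2 : ℝ) ≤ n := by exact_mod_cast hn2
    have hnpos : (0 : ℝ) < n := by linarith
    set v : ℝ → ℂ := fun θ => Complex.exp (θ * Complex.I) with hv
    have vpow : ∀ θ : ℝ, v θ ^ n = Complex.exp ((n * θ : ℝ) * Complex.I) := by
      intro θ
      rw [hv]
      simp only
      rw [← Complex.exp_nat_mul]
      push_cast
      ring_nf
    have hπ := pi_pos
    obtain ⟨θ1, ht1, ht2, ht3⟩ : ∃ θ1 : ℝ, -(π / 2) < θ1 ∧ θ1 + π / n < π / 2 ∧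
        (v θ1 ^ n * g l0).re ≠ 0 := by
      by_contra hcon
      push Not at hcon
      have hnn : π / n ≤ π / 2 := by gcongr
      have hnn0 : 0 < π / n := by positivity
      have c1 := hcon (-(π / n) / 2) (by linarith) (by linarith)
      have c2 := hcon (-(π / n) / 4) (by linarith) (by linarith)
      rw [vpow] at c1 c2
      have e1 : (n : ℝ) * (-(π / n) / 2) = -(π / 2) := by field_simp
      have e2 : (n : ℝ) * (-(π / n) / 4) = -(π / 4) := by field_simp
      rw [e1] at c1
      rw [e2] at c2
      rw [Complex.mul_re, Complex.exp_ofReal_mul_I_re, Complex.exp_ofReal_mul_I_im, cos_neg,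
        sin_neg] at c1 c2
      rw [cos_pi_div_two, sin_pi_div_two] at c1
      rw [cos_pi_div_four, sin_pi_div_four] at c2
      have i0 : (g l0).im = 0 := by linarith
      rw [i0] at c2
      have hs : (√2 / 2 : ℝ) ≠ 0 := by positivity
      have r0 : (g l0).re = 0 := by
        have : √2 / 2 * (g l0).re = 0 := by linarith
        exact (mul_eq_zero.1 this).resolve_left hs
      exact hg0 (Complex.ext r0 i0)
    set θ2 := θ1 + π / n with hθ2
    have hv2 : v θ2 ^ n = - v θ1 ^ n := by
      rw [vpow, vpow, hθ2]
      have : ((n * (θ1 + π / n) : ℝ) : ℂ) * Complex.I = ((n * θ1 : ℝ) : ℂ) * Complex.I + π * Complex.I := by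
        have : (n * (θ1 + π / n) : ℝ) = n * θ1 + π := by field_simp
        rw [this]; push_cast; ring
      rw [this, Complex.exp_add, Complex.exp_pi_mul_I]
      ring
    set q := (v θ1 ^ n * g l0).re with hq
    -- sign condition along rays
    have ray : ∀ θ : ℝ, Tendsto (fun r : ℝ => (v θ ^ n * g (l0 + r * v θ)).re) (nhdsWithin 0 (Ioi 0))
        (nhds (v θ ^ n * g l0).re) := by
      intro θ
      have hc : ContinuousAt (fun r : ℝ => (v θ ^ n * g (l0 + r * v θ)).re) 0 := by
        have g1 : ContinuousAt g (l0 + ((0:ℝ) : ℂ) * v θ) := by simpa using hg.continuousAt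
        have g2 : ContinuousAt (fun r : ℝ => l0 + (r : ℂ) * v θ) 0 := by fun_prop
        have g3 : ContinuousAt (fun r : ℝ => g (l0 + (r : ℂ) * v θ)) 0 :=
          ContinuousAt.comp (f := fun r : ℝ => l0 + (r : ℂ) * v θ) g1 g2
        exact Complex.continuous_re.continuousAt.comp (continuousAt_const.mul g3)
      have := hc.tendsto
      simp only [Complex.ofReal_zero, zero_mul, add_zero] at this
      exact this.mono_left nhdsWithin_le_nhds
    have ev1 : ∀ᶠ r : ℝ in nhdsWithin 0 (Ioi 0), 0 < q * (v θ1 ^ n * g (l0 + r * v θ1)).re := by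
      have := (ray θ1).const_mul q
      refine this.eventually_const_lt ?_
      rw [← hq]
      exact mul_self_pos.2 ht3
    have ev2 : ∀ᶠ r : ℝ in nhdsWithin 0 (Ioi 0), q * (v θ2 ^ n * g (l0 + r * v θ2)).re < 0 := by
      have := (ray θ2).const_mul q
      refine this.eventually_lt_const ?_
      rw [hv2, neg_mul, Complex.neg_re, ← hq]
      have := mul_self_pos.2 ht3
      linarith
    obtain ⟨ε, hε, hsub⟩ := Metric.mem_nhds_iff.1
      (inter_mem (inter_mem hU heq) ha.eventually_continuousAt)
    obtain ⟨r, ⟨hr1, hr2⟩, hr3⟩ := ((ev1.and ev2).and (Ioo_mem_nhdsGT hε)).exists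
    have hr0 : 0 < r := hr3.1
    have hin : ∀ θ : ℝ, l0 + r * v θ ∈ Metric.ball l0 ε := by
      intro θ
      rw [Metric.mem_ball, dist_eq_norm, add_sub_cancel_left, norm_mul, Complex.norm_real,
        Real.norm_eq_abs, abs_of_pos hr0, hv]
      simp only
      rw [Complex.norm_exp_ofReal_mul_I, mul_one]
      exact hr3.2
    have hval : ∀ θ : ℝ, (h (l0 + r * v θ)).re = r ^ n * (v θ ^ n * g (l0 + r * v θ)).re := by
      intro θ
      have : h (l0 + r * v θ) = (l0 + r * v θ - l0) ^ n • g (l0 + r * v θ) := (hsub (hin θ)).1.2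
      rw [this, add_sub_cancel_left, smul_eq_mul, mul_pow, mul_assoc, ← Complex.ofReal_pow,
        Complex.re_ofReal_mul]
    have hcont : Continuous (fun θ : ℝ => (h (l0 + r * v θ)).re) := by
      refine Complex.continuous_re.comp ?_
      rw [continuous_iff_continuousAt]
      intro θ
      have c1 : ContinuousAt h (l0 + r * v θ) := (hsub (hin θ)).2
      have c2 : ContinuousAt (fun θ : ℝ => l0 + r * v θ) θ := by
        rw [hv]; fun_prop
      exact ContinuousAt.comp (f := fun θ : ℝ => l0 + r * v θ) c1 c2
    have hle : θ1 ≤ θ2 := by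
      have : 0 < π / n := by positivity
      linarith
    have hrn : 0 < r ^ n := by positivity
    have hivt : (0 : ℝ) ∈ (fun θ : ℝ => q * (h (l0 + r * v θ)).re) '' Icc θ1 θ2 := by
      refine intermediate_value_Icc' hle (hcont.const_mul q).continuousOn ⟨?_, ?_⟩
      · rw [hval]; nlinarith
      · rw [hval]; nlinarith
    obtain ⟨θ, hθ, hθ0⟩ := hivt
    refine ⟨l0 + r * v θ, (hsub (hin θ)).1.1, ?_, ?_⟩
    · rw [Complex.add_re, Complex.re_ofReal_mul, hv]
      simp only
      rw [Complex.exp_ofReal_mul_I_re]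
      have : 0 < cos θ := cos_pos_of_mem_Ioo ⟨by linarith [hθ.1], by linarith [hθ.2]⟩
      have := mul_pos hr0 this
      linarith
    · exact (mul_eq_zero.1 hθ0).resolve_left ht3

theorem floquet {P : ℝ → ℝ} {T : ℝ} (hper : ∀ z, P (z + T) = P z) {ν ρ : ℂ}
    {Y1 Y1d Y2 Y2d : ℝ → ℂ} (F : CFund (fun z => ν - (P z : ℂ)) Y1 Y1d Y2 Y2d)
    (hρ : ρ ^ 2 - (Y1 T + Y2d T) * ρ + 1 = 0) :
    ∃ y yd : ℝ → ℂ, (∀ z, HasDerivAt y (yd z) z) ∧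
      (∀ z, HasDerivAt yd ((ν - (P z : ℂ)) * y z) z) ∧ (∃ z, y z ≠ 0) ∧
      ∀ z, y (z + T) = ρ * y z := by
  have w := F.wronsk T
  obtain ⟨p, r, hpr, e1, e2⟩ : ∃ p r : ℂ, (p ≠ 0 ∨ r ≠ 0) ∧ p * Y1 T + r * Y2 T = ρ * p ∧
      p * Y1d T + r * Y2d T = ρ * r := by
    by_cases hB : Y2 T = 0
    · by_cases hE : Y2d T = ρ
      · exact ⟨0, 1, Or.inr one_ne_zero, by rw [hB]; ring, by rw [hE]; ring⟩
      · have hA : Y1 T = ρ := by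
          rw [hB] at w
          have : (Y1 T - ρ) * (Y2d T - ρ) = 0 := by linear_combination w + hρ
          rcases mul_eq_zero.1 this with h | h
          · exact sub_eq_zero.1 h
          · exact absurd (sub_eq_zero.1 h) hE
        exact ⟨ρ - Y2d T, Y1d T, Or.inl (sub_ne_zero.2 (Ne.symm hE)), by rw [hB, hA]; ring, by ring⟩
    · exact ⟨Y2 T, ρ - Y1 T, Or.inl hB, by ring, by linear_combination -w - hρ⟩
  have hy : ∀ z, HasDerivAt (fun z => p * Y1 z + r * Y2 z) (p * Y1d z + r * Y2d z) z :=
    fun z => ((F.h1 z).const_mul p).add ((F.h2 z).const_mul r)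
  have hyd : ∀ z, HasDerivAt (fun z => p * Y1d z + r * Y2d z)
      ((ν - (P z : ℂ)) * (p * Y1 z + r * Y2 z)) z := by
    intro z
    convert! ((F.h1d z).const_mul p).add ((F.h2d z).const_mul r) using 1
    ring
  refine ⟨_, _, hy, hyd, ?_, ?_⟩
  · by_contra hcon
    push Not at hcon
    have p0 := hcon 0
    rw [F.i1, F.i2] at p0
    have d0 := hy 0
    rw [show (fun z => p * Y1 z + r * Y2 z) = fun _ => 0 from funext hcon] at d0
    have r0 := d0.unique (hasDerivAt_const (0:ℝ) (0:ℂ))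
    rw [F.i1d, F.i2d] at r0
    simp at p0 r0
    simp [p0, r0] at hpr
  · intro z
    have := (F.uniq (y := fun z => p * Y1 (z + T) + r * Y2 (z + T))
      (yd := fun z => p * Y1d (z + T) + r * Y2d (z + T))
      (fun z => (hy (z + T)).comp_add_const z T)
      (fun z => by
        have := (hyd (z + T)).comp_add_const z T
        rwa [hper] at this) z).1
    simp only [zero_add] at this
    rw [this, e1, e2]
    ring

theorem mem_spectrum {P Q : ℝ → ℝ} {T c : ℝ} (hT : 0 < T) (hc : c ^ 2 > 1)
    (hQ : ∀ z, Q z = (c ^ 2 - 1) * P z)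
    (hper : ∀ z, P (z + T) = P z) {l ρ : ℂ} {Y1 Y1d Y2 Y2d : ℝ → ℂ}
    (F : CFund (fun z => (l / ((c : ℂ) ^ 2 - 1)) ^ 2 - (P z : ℂ)) Y1 Y1d Y2 Y2d)
    (hρ : ρ ^ 2 - (Y1 T + Y2d T) * ρ + 1 = 0)
    (hmod : ‖Complex.exp ((c * l / ((c : ℂ) ^ 2 - 1)) * T) * ρ‖ = 1) : l ∈ KGSpectrum c Q := by
  obtain ⟨y, yd, hy, hyd, ⟨z0, hz0⟩, hfl⟩ := floquet hper F hρ
  have hκ : ((c : ℂ) ^ 2 - 1) ≠ 0 := by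
    have : ((c ^ 2 - 1 : ℝ) : ℂ) ≠ 0 := by
      rw [Complex.ofReal_ne_zero]; linarith
    push_cast at this
    exact this
  set α := c * l / ((c : ℂ) ^ 2 - 1) with hα
  set ν := (l / ((c : ℂ) ^ 2 - 1)) ^ 2 with hν
  have he : ∀ z : ℝ, HasDerivAt (fun z : ℝ => Complex.exp (α * z)) (Complex.exp (α * z) * α) z := by
    intro z
    have := ((hasDerivAt_id z).ofReal_comp.const_mul α).cexp
    simpa using this
  have hw : ∀ z : ℝ, HasDerivAt (fun z : ℝ => Complex.exp (α * z) * y z)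
      (Complex.exp (α * z) * (α * y z + yd z)) z := by
    intro z
    convert! (he z).mul (hy z) using 1
    ring
  refine ⟨fun z => Complex.exp (α * z) * y z, fun z => Complex.exp (α * z) * (α * y z + yd z),
    fun z => Complex.exp (α * z) * (α ^ 2 * y z + 2 * α * yd z + (ν - P z) * y z), hw, ?_, ?_,
    ⟨z0, mul_ne_zero (Complex.exp_ne_zero _) hz0⟩, ?_⟩
  · intro z
    convert! (he z).mul (((hy z).const_mul α).add (hyd z)) using 1
    simp only [Pi.add_apply]
    ring
  · intro z
    rw [hQ z, hν, hα]
    push_cast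
    field_simp
    ring
  · have hcontw : Continuous (fun z : ℝ => Complex.exp (α * z) * y z) :=
      continuous_iff_continuousAt.2 fun z => (hw z).continuousAt
    have hp : Function.Periodic (fun z : ℝ => ‖Complex.exp (α * z) * y z‖) T := by
      intro z
      simp only
      have : Complex.exp (α * ((z + T : ℝ) : ℂ)) * y (z + T) =
          (Complex.exp (α * T) * ρ) * (Complex.exp (α * z) * y z) := by
        rw [hfl z]
        push_cast
        rw [mul_add, Complex.exp_add]
        ring
      rw [this, norm_mul, hmod, one_mul]
    have := hp.isBounded_of_continuous hT.ne' hcontw.norm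
    obtain ⟨M, hM⟩ := this.exists_norm_le
    refine ⟨M, fun z => ?_⟩
    have := hM _ (mem_range_self z)
    simpa using this


theorem dhh_abstract {D : ℂ → ℂ} (hD : Differentiable ℂ D) {ν0 δ d κ c T : ℝ} (hν : ν0 < 0)
    (hD0 : D ν0 = δ) (hd : HasDerivAt D (d : ℂ) (ν0 : ℂ)) (hκ : 0 < κ) (hc : c ≠ 0) (hT : 0 < T)
    (hδ : δ ^ 2 < 4) (hrel : c ^ 2 * T ^ 2 * (4 - δ ^ 2) = 4 * (-ν0) * d ^ 2)
    {U : Set ℂ} (hU : U ∈ nhds (Complex.I * ((κ * √(-ν0) : ℝ) : ℂ))) :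
    ∃ l ∈ U, 0 < l.re ∧ ∃ ρ : ℂ, ρ ^ 2 - D ((l / (κ : ℂ)) ^ 2) * ρ + 1 = 0 ∧
      ‖Complex.exp ((c * l / (κ : ℂ)) * T) * ρ‖ = 1 := by
  set k := √(-ν0) with hk
  have hk2 : k ^ 2 = -ν0 := Real.sq_sqrt (by linarith)
  set l0 : ℂ := Complex.I * ((κ * k : ℝ) : ℂ) with hl0
  set s0 : ℝ := -2 * k * d / (c * T) with hs0
  have hs2 : s0 ^ 2 = 4 - δ ^ 2 := by
    rw [hs0]
    have : c * T ≠ 0 := mul_ne_zero hc hT.ne'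
    field_simp
    rw [hk2]
    linarith
  have hsne : s0 ≠ 0 := by
    intro h
    rw [h] at hs2
    nlinarith
  have hκc : (κ : ℂ) ≠ 0 := by exact_mod_cast hκ.ne'
  have hsc : (s0 : ℂ) ≠ 0 := by exact_mod_cast hsne
  have hcc : (c : ℂ) ≠ 0 := by exact_mod_cast hc
  have hTc : (T : ℂ) ≠ 0 := by exact_mod_cast hT.ne'
  have hs2c : (s0 : ℂ) ^ 2 = 4 - (δ : ℂ) ^ 2 := by exact_mod_cast hs2
  have hl0k : l0 / κ = Complex.I * k := by
    rw [hl0]; push_cast; field_simp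
  have hl0sq : (l0 / κ) ^ 2 = (ν0 : ℂ) := by
    rw [hl0k, mul_pow, Complex.I_sq, ← Complex.ofReal_pow, hk2]
    push_cast; ring
  set Dl : ℂ → ℂ := fun l => D ((l / κ) ^ 2) with hDl
  have hDlD : Differentiable ℂ Dl := hD.comp (by fun_prop)
  have hDl0 : Dl l0 = δ := by simp only [hDl]; rw [hl0sq, hD0]
  have hDl' : HasDerivAt Dl (d * (2 * (Complex.I * k) / κ)) l0 := by
    have h1 : HasDerivAt (fun l : ℂ => (l / κ) ^ 2) (2 * (Complex.I * k) / κ) l0 := by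
      convert! ((hasDerivAt_id l0).div_const (κ : ℂ)).pow 2 using 1
      simp only [id]
      rw [hl0k]
      push_cast
      ring
    have h2 : HasDerivAt D (d : ℂ) ((l0 / κ) ^ 2) := by rw [hl0sq]; exact hd
    exact HasDerivAt.comp (h₂ := D) (h := fun l : ℂ => (l / κ) ^ 2) l0 h2 h1
  set q : ℂ → ℂ := fun l => (4 - Dl l ^ 2) / (s0 : ℂ) ^ 2 with hq
  have hqD : Differentiable ℂ q := by
    have : Differentiable ℂ fun l => 4 - Dl l ^ 2 := (hDlD.pow 2).const_sub 4
    exact this.div_const _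
  have hq0 : q l0 = 1 := by
    simp only [hq]; rw [hDl0, ← hs2c]; exact div_self (pow_ne_zero 2 hsc)
  have hq' : HasDerivAt q (-(2 * δ * (d * (2 * (Complex.I * k) / κ))) / (s0 : ℂ) ^ 2) l0 := by
    convert! ((hDl'.pow 2).const_sub 4).div_const ((s0 : ℂ) ^ 2) using 1
    rw [hDl0]; push_cast; ring
  have hq1 : q l0 ∈ Complex.slitPlane := by rw [hq0]; exact Complex.one_mem_slitPlane
  set S : ℂ → ℂ := fun l => s0 * Complex.exp (Complex.log (q l) / 2) with hS
  have hS0 : S l0 = s0 := by simp [hS, hq0]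
  have hS' : HasDerivAt S (-(δ * (d * (2 * (Complex.I * k) / κ))) / (s0 : ℂ)) l0 := by
    convert! (((hq'.clog hq1).div_const 2).cexp).const_mul (s0 : ℂ) using 1
    rw [hq0]
    simp
    field_simp
  have hSA : AnalyticAt ℂ S l0 := by
    have := ((hqD.analyticAt l0).clog hq1)
    exact analyticAt_const.mul ((this.div_const).cexp)
  have hSsq : ∀ l, q l ≠ 0 → S l ^ 2 = 4 - Dl l ^ 2 := by
    intro l hl
    simp only [hS]
    rw [mul_pow, ← Complex.exp_nat_mul]
    push_cast
    rw [mul_div_cancel₀ _ (two_ne_zero), Complex.exp_log hl]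
    simp only [hq]
    field_simp
  set ρ : ℂ → ℂ := fun l => (Dl l + Complex.I * S l) / 2 with hρ
  have hρ0 : ρ l0 = (δ + Complex.I * s0) / 2 := by simp [hρ, hDl0, hS0]
  have hρn : ‖ρ l0‖ = 1 := by
    have : Complex.normSq (ρ l0) = 1 := by
      rw [hρ0]
      simp [Complex.normSq_apply]
      nlinarith
    rw [Complex.norm_def, this, Real.sqrt_one]
  have hρne : ρ l0 ≠ 0 := by
    intro h; rw [h] at hρn; simp at hρn
  have hρ' : HasDerivAt ρ (-(c * T / κ) * ρ l0) l0 := by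
    convert! (hDl'.add (hS'.const_mul Complex.I)).div_const 2 using 1
    rw [hρ0]
    have e : (c * T : ℂ) * s0 = - 2 * k * d := by
      have : c * T * s0 = -2 * k * d := by rw [hs0]; field_simp
      exact_mod_cast this
    field_simp
    linear_combination (-(δ + Complex.I * s0)) * e + (2 * δ * k * d) * Complex.I_sq
  have hρA : AnalyticAt ℂ ρ l0 :=
    ((hDlD.analyticAt l0).add (analyticAt_const.mul hSA)).div_const
  have hr1 : ρ l0 / ρ l0 ∈ Complex.slitPlane := by
    rw [div_self hρne]; exact Complex.one_mem_slitPlane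
  set h : ℂ → ℂ := fun l => c * T / κ * (l - l0) + Complex.log (ρ l / ρ l0) with hh
  have hA : AnalyticAt ℂ h l0 := by
    refine AnalyticAt.add ?_ ((hρA.div_const).clog hr1)
    exact analyticAt_const.mul (analyticAt_id.sub analyticAt_const)
  have h0 : h l0 = 0 := by simp [hh, div_self hρne]
  have h1 : deriv h l0 = 0 := by
    have : HasDerivAt h (c * T / κ * 1 + (-(c * T / κ) * ρ l0 / ρ l0) / (ρ l0 / ρ l0)) l0 :=
      (((hasDerivAt_id l0).sub_const l0).const_mul _).add ((hρ'.div_const (ρ l0)).clog hr1)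
    rw [this.deriv, div_self hρne, mul_div_cancel_right₀ _ hρne]
    ring
  have n1 : ∀ᶠ l in nhds l0, q l ≠ 0 :=
    (hqD l0).continuousAt.eventually_ne (by rw [hq0]; exact one_ne_zero)
  have n2 : ∀ᶠ l in nhds l0, ρ l ≠ 0 := hρA.continuousAt.eventually_ne hρne
  obtain ⟨l, hl, hre, hhl⟩ := off_axis hA h0 h1 (inter_mem hU (n1.and n2))
  obtain ⟨hlU, hlq, hlρ⟩ := hl
  have hl0re : l0.re = 0 := by simp [hl0]
  refine ⟨l, hlU, by rw [← hl0re]; exact hre, ρ l, ?_, ?_⟩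
  · have := hSsq l hlq
    change ρ l ^ 2 - Dl l * ρ l + 1 = 0
    simp only [hρ]
    linear_combination (-1/4) * this + (S l ^ 2 / 4) * Complex.I_sq
  · rw [norm_mul, Complex.norm_exp]
    have e1 : (c * l / κ * T : ℂ) = ((c * T / κ : ℝ) : ℂ) * l := by push_cast; ring
    have e2 : (h l).re = c * T / κ * l.re + Real.log ‖ρ l‖ := by
      simp only [hh]
      rw [Complex.add_re, Complex.log_re, norm_div, hρn, div_one]
      have : (c * T / κ * (l - l0) : ℂ) = ((c * T / κ : ℝ) : ℂ) * (l - l0) := by push_cast; ring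
      rw [this, Complex.re_ofReal_mul, Complex.sub_re, hl0re, sub_zero]
    rw [e1, Complex.re_ofReal_mul]
    have hpos : 0 < ‖ρ l‖ := norm_pos_iff.2 hlρ
    rw [← Real.exp_log hpos, ← Real.exp_add, Real.exp_eq_one_iff]
    linarith

theorem dhh_at {P Q : ℝ → ℝ} {y1 y1d y2 y2d : ℝ → ℝ → ℝ}
    (hf : IsHillFundamental P y1 y1d y2 y2d) (hP : Continuous P) {T c : ℝ} (hT : 0 < T)
    (hper : ∀ z, P (z + T) = P z) (hc : c ^ 2 > 1) (hQ : ∀ z, Q z = (c ^ 2 - 1) * P z)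
    (Δ : ℝ → ℝ) (hΔ : Δ = fun ν => y1 ν T + y2d ν T) {ν0 : ℝ} (hν : ν0 < 0) (h4 : Δ ν0 ^ 2 < 4)
    (hrel : c ^ 2 * T ^ 2 * (4 - Δ ν0 ^ 2) + 4 * ν0 * deriv Δ ν0 ^ 2 = 0) :
    HasDHHInstabilityAt c Q (Complex.I * ((|c ^ 2 - 1| * √(-ν0) : ℝ) : ℂ)) := by
  intro U hU
  obtain ⟨-, -, hform⟩ := hill_delta_smooth hf hP T Δ hΔ
  obtain ⟨Y1, Y1d, Y2, Y2d, CF, e1, e2, r1, r2, r3, r4, d1, -, -, d4⟩ := hill_complex hf hP ν0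
  rw [abs_of_pos (by linarith)] at hU
  have hd : HasDerivAt (fun ν => Y1 ν T + Y2d ν T) ((deriv Δ ν0 : ℝ) : ℂ) (ν0 : ℂ) := by
    rw [hform]
    push_cast
    exact (d1 T).add (d4 T)
  obtain ⟨l, hlU, hl, ρ, hρ, hm⟩ := dhh_abstract (D := fun ν => Y1 ν T + Y2d ν T)
    ((e1 T).add (e2 T)) hν (δ := Δ ν0) (by simp only [r1, r4, hΔ]; push_cast; rfl) hd
    (κ := c ^ 2 - 1) (by linarith) (c := c) (by rintro rfl; norm_num at hc) hT h4 (by linarith) hU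
  push_cast at hρ hm
  exact ⟨l, mem_spectrum hT hc hQ hper (CF _) hρ hm, hlU, hl.ne'⟩


theorem coeff_periodic {P : ℝ → ℝ} {y1 y1d y2 y2d : ℝ → ℝ → ℝ}
    (hf : IsHillFundamental P y1 y1d y2 y2d) (hP : Continuous P) {T : ℝ} {g gd : ℝ → ℝ}
    (hg : ∀ z, HasDerivAt g (gd z) z) (hgd : ∀ z, HasDerivAt gd (-(P z * g z)) z)
    (hper : ∀ z, g (z + T) = g z) (hnt : ∃ z, g z ≠ 0) (z : ℝ) : P (z + T) = P z := by
  have hgdper : ∀ z, gd (z + T) = gd z := by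
    intro z
    have h1 := (hg (z + T)).comp_add_const z T
    rw [show (fun x => g (x + T)) = g from funext hper] at h1
    exact h1.unique (hg z)
  have hprod : ∀ z, (P (z + T) - P z) * g z = 0 := by
    intro z
    have h1 := (hgd (z + T)).comp_add_const z T
    rw [show (fun x => gd (x + T)) = gd from funext hgdper] at h1
    have := h1.unique (hgd z)
    rw [hper] at this
    linarith
  by_contra hne
  have hev : ∀ᶠ x in nhds z, g x = 0 := by
    have hc : Continuous (fun x => P (x + T) - P x) := by fun_prop
    filter_upwards [hc.continuousAt.eventually_ne (sub_ne_zero.2 hne)] with x hx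
    exact (mul_eq_zero.1 (hprod x)).resolve_left hx
  have g0 : g z = 0 := hev.self_of_nhds
  have gd0 : gd z = 0 := by
    have h1 : HasDerivAt g 0 z :=
      (hasDerivAt_const z (0:ℝ)).congr_of_eventuallyEq hev
    exact (hg z).unique h1
  obtain ⟨Y1, Y1d, Y2, Y2d, CF, -⟩ := hill_complex hf hP 0
  have F := CF 0
  have u := F.uniq (y := fun z => (g z : ℂ)) (yd := fun z => (gd z : ℂ))
    (fun z => (hg z).ofReal_comp) (fun z => by
      have := (hgd z).ofReal_comp
      convert! this using 1
      push_cast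
      ring)
  have w := F.wronsk z
  obtain ⟨u1, u2⟩ := u z
  simp only [g0, gd0, Complex.ofReal_zero] at u1 u2
  have a0 : (g 0 : ℂ) = 0 := by
    linear_combination (-(g 0 : ℂ)) * w - Y2d 0 z * u1 + Y2 0 z * u2
  have b0 : (gd 0 : ℂ) = 0 := by
    linear_combination (-(gd 0 : ℂ)) * w + Y1d 0 z * u1 - Y1 0 z * u2
  obtain ⟨x, hx⟩ := hnt
  have := (u x).1
  rw [a0, b0, zero_mul, zero_mul, add_zero] at this
  exact hx (by exact_mod_cast this)

theorem dhh_pair_near_deep_gaps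
    (V : ℝ → ℝ) (hV : ContDiff ℝ 2 V)
    (c : ℝ) (hc : c ^ 2 ≠ 1)
    (f fd fdd : ℝ → ℝ)
    (hf : ∀ z, HasDerivAt f (fd z) z)
    (hfd : ∀ z, HasDerivAt fd (fdd z) z)
    (hwave : ∀ z, (c ^ 2 - 1) * fdd z + deriv V (f z) = 0)
    (T : ℝ) (hT : 0 < T)
    (hper : ∀ z, fd (z + T) = fd z)
    (hnt : ∃ z, fd z ≠ 0)
    (Q : ℝ → ℝ) (hQ : Q = fun z => deriv (deriv V) (f z))
    (P : ℝ → ℝ) (hP : P = fun z => Q z / (c ^ 2 - 1))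
    (y1 y1d y2 y2d : ℝ → ℝ → ℝ)
    (hfund : IsHillFundamental P y1 y1d y2 y2d)
    (Δ : ℝ → ℝ) (hΔ : Δ = fun ν => y1 ν T + y2d ν T)
    (hsuper : c ^ 2 > 1)
    (F : ℝ → ℝ)
    (hF : F = fun ν => -(c ^ 2 * T ^ 2 * (4 - Δ ν ^ 2)) / (4 * (deriv Δ ν) ^ 2))
 :
    ∃ N > (0 : ℝ), ∀ a b : ℝ, a < b → b < -N →
      Δ a ^ 2 = 4 → Δ b ^ 2 = 4 → (∀ ν ∈ Set.Ioo a b, Δ ν ^ 2 > 4) →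
      ∃ ν₁ ν₂ : ℝ, ν₁ < a ∧ b < ν₂ ∧ ν₂ < 0 ∧
        (Δ ν₁ ^ 2 < 4 ∧ deriv Δ ν₁ ≠ 0 ∧ F ν₁ = ν₁) ∧
        (Δ ν₂ ^ 2 < 4 ∧ deriv Δ ν₂ ≠ 0 ∧ F ν₂ = ν₂) ∧
        0 < |c ^ 2 - 1| * Real.sqrt (-ν₁) ∧
        0 < |c ^ 2 - 1| * Real.sqrt (-ν₂) ∧
        |c ^ 2 - 1| * Real.sqrt (-ν₁) ≠ |c ^ 2 - 1| * Real.sqrt (-ν₂) ∧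
        HasDHHInstabilityAt c Q (Complex.I * ((|c ^ 2 - 1| * Real.sqrt (-ν₁) : ℝ) : ℂ)) ∧
        HasDHHInstabilityAt c Q (Complex.I * ((|c ^ 2 - 1| * Real.sqrt (-ν₂) : ℝ) : ℂ)) := by
  have hκ : 0 < c ^ 2 - 1 := by linarith
  have hfc : Continuous f := continuous_iff_continuousAt.2 fun z => (hf z).continuousAt
  have hV1 : ContDiff ℝ 1 (deriv V) := by
    have : ContDiff ℝ (1 + 1) V := by
      rw [one_add_one_eq_two]; exact hV
    exact (contDiff_succ_iff_deriv.1 this).2.2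
  have hQc : Continuous Q := by
    rw [hQ]
    exact (hV1.continuous_deriv le_rfl).comp hfc
  have hPc : Continuous P := by rw [hP]; exact hQc.div_const _
  have hQP : ∀ z, Q z = (c ^ 2 - 1) * P z := by
    intro z; rw [hP]; simp only; field_simp
  have hfdd : ∀ z, HasDerivAt fdd (-(P z * fd z)) z := by
    intro z
    have e : fdd = fun z => -(deriv V (f z)) / (c ^ 2 - 1) := by
      ext z
      rw [eq_div_iff hκ.ne']
      linarith [hwave z]
    have h1 : HasDerivAt (deriv V) (deriv (deriv V) (f z)) (f z) :=
      (hV1.differentiable one_ne_zero (f z)).hasDerivAt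
    rw [e]
    convert! ((h1.comp z (hf z)).neg).div_const (c ^ 2 - 1) using 1
    rw [hP, hQ]
    simp only
    ring
  have hPper : ∀ z, P (z + T) = P z := coeff_periodic hfund hPc hfd hfdd hper hnt
  obtain ⟨hΔd, hΔc, -⟩ := hill_delta_smooth hfund hPc T Δ hΔ
  obtain ⟨N0, hN0, hN⟩ := hill_deriv_bound hfund hPc hT Δ hΔ hsuper
  obtain ⟨m0, hm0, hm0z⟩ := hill_zeros hfund hPc hT Δ hΔ (-N0)
  have hΔcont : Continuous Δ := continuous_iff_continuousAt.2 fun z => (hΔd z).continuousAt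
  set G : ℝ → ℝ := fun ν => c ^ 2 * T ^ 2 * (4 - Δ ν ^ 2) + 4 * ν * deriv Δ ν ^ 2 with hG
  have hGc : Continuous G := by rw [hG]; fun_prop
  have hcT : 0 < c ^ 2 * T ^ 2 := by have := pow_pos hT 2; have : 0 < c ^ 2 := by linarith
                                     positivity
  have hz : ∀ ν < -N0, Δ ν = 0 → 0 < G ν := by
    intro ν hν h0
    have := hN ν hν
    simp only [hG]
    rw [h0]
    nlinarith
  have hcr : ∀ ν, deriv Δ ν = 0 → Δ ν ^ 2 < 4 → 0 < G ν := by
    intro ν h0 h4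
    simp only [hG]
    rw [h0]
    have := mul_pos hcT (sub_pos.2 h4)
    simpa using this
  have hsqd : ∀ ν, HasDerivAt (fun ν => Δ ν ^ 2) (2 * Δ ν * deriv Δ ν) ν := by
    intro ν
    convert! (hΔd ν).pow 2 using 1
    push_cast
    ring
  have hfin : ∀ ν, ν < 0 → Δ ν ^ 2 < 4 → G ν = 0 → deriv Δ ν ≠ 0 ∧ F ν = ν ∧
      0 < |c ^ 2 - 1| * Real.sqrt (-ν) ∧
      HasDHHInstabilityAt c Q (Complex.I * ((|c ^ 2 - 1| * Real.sqrt (-ν) : ℝ) : ℂ)) := by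
    intro ν hν h4 hG0
    have hd : deriv Δ ν ≠ 0 := fun h => (hcr ν h h4).ne' hG0
    refine ⟨hd, ?_, mul_pos (abs_pos.2 hκ.ne') (Real.sqrt_pos.2 (by linarith)),
      dhh_at hfund hPc hT hPper hsuper hQP Δ hΔ hν h4 hG0⟩
    rw [hF]
    simp only
    rw [div_eq_iff (by positivity)]
    simp only [hG] at hG0
    linarith
  refine ⟨-m0, by linarith, ?_⟩
  intro a b hab hb ha4 hb4 hgap
  rw [neg_neg] at hb
  have hda : deriv Δ a ≠ 0 := by
    intro h0
    have h1 := hill_edge hfund hPc hT Δ hΔ a ha4 h0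
    have h2 : ∀ᶠ ν in nhdsWithin a (Ioi a), Δ ν ^ 2 < 4 :=
      h1.filter_mono (nhdsWithin_mono a fun x (hx : a < x) => hx.ne')
    obtain ⟨x, hx, hx2⟩ := (h2.and (Ioo_mem_nhdsGT hab)).exists
    exact absurd (hgap x hx2) (by linarith)
  have hdb : deriv Δ b ≠ 0 := by
    intro h0
    have h1 := hill_edge hfund hPc hT Δ hΔ b hb4 h0
    have h2 : ∀ᶠ ν in nhdsWithin b (Iio b), Δ ν ^ 2 < 4 :=
      h1.filter_mono (nhdsWithin_mono b fun x (hx : x < b) => hx.ne)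
    obtain ⟨x, hx, hx2⟩ := (h2.and (Ioo_mem_nhdsLT hab)).exists
    exact absurd (hgap x hx2) (by linarith)
  have hne : ∀ x, Δ x ^ 2 = 4 → Δ x ≠ 0 := by
    intro x hx h; rw [h] at hx; norm_num at hx
  have hl := edge_left (hsqd a) (mul_ne_zero (mul_ne_zero two_ne_zero (hne a ha4)) hda) ha4 hab hgap
  have hr := edge_right (hsqd b) (mul_ne_zero (mul_ne_zero two_ne_zero (hne b hb4)) hdb) hb4 hab hgap
  have hGneg : ∀ x, x < 0 → Δ x ^ 2 = 4 → deriv Δ x ≠ 0 → G x < 0 := by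
    intro x hx h4 hd
    simp only [hG]
    rw [h4]
    have : 0 < deriv Δ x ^ 2 := by positivity
    nlinarith
  obtain ⟨m, hma, hmz⟩ := hill_zeros hfund hPc hT Δ hΔ a
  obtain ⟨ν₁, h1m, h14, h1G⟩ := gap_left hΔd hGc hma hmz ha4 hl (hGneg a (by linarith) ha4 hda)
    (fun ν hν => hz ν (by linarith [hν.2])) (fun ν _ => hcr ν)
  obtain ⟨ν₂, h2m, h24, h2G⟩ := gap_right hΔd hGc hb hm0z hb4 hr (hGneg b (by linarith) hb4 hdb)
    (fun ν hν => hz ν (by linarith [hν.2])) (fun ν _ => hcr ν)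
  have n1 : ν₁ < 0 := by linarith [h1m.2]
  have n2 : ν₂ < 0 := by linarith [h2m.2]
  obtain ⟨p1, p2, p3, p4⟩ := hfin ν₁ n1 h14 h1G
  obtain ⟨q1, q2, q3, q4⟩ := hfin ν₂ n2 h24 h2G
  refine ⟨ν₁, ν₂, h1m.2, h2m.1, n2, ⟨h14, p1, p2⟩, ⟨h24, q1, q2⟩, p3, q3, ?_, p4, q4⟩
  intro heq
  have := mul_left_cancel₀ (abs_pos.2 hκ.ne').ne' heq
  rw [Real.sqrt_inj (by linarith) (by linarith)] at this
  linarith [h1m.2, h2m.1]
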